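/- arXiv:1807.03961 — 4 statements merged into one kernel-verified Lean document; each statement's English description precedes it below -/
import Mathlib

section
/- Let ν and ν_n (n ∈ ℕ) be nonnegative finite Borel measures on ℝ^N such that ν_n converges weakly-* to ν in M(ℝ^N), i.e. ∫_{ℝ^N} f dν_n → ∫_{ℝ^N} f dν for every continuous function f : ℝ^N → ℝ vanishing at infinity. Then for every continuous r : ℝ^N → ℝ with 1 < inf r ≤ sup r < ∞ and every continuous compactly supported φ : ℝ^N → ℝ, one has |φ|_{L^{r(x)}_{ν_n}(ℝ^N)} → |φ|_{L^{r(x)}_{ν}(ℝ^N)} as n → ∞. -/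
open MeasureTheory Filter Topology

/-- The Luxemburg norm `|φ|_{L^{r(x)}_μ(ℝ^N)}` with respect to a measure `μ`. -/
noncomputable def luxNormM {N : ℕ} (μ : Measure (EuclideanSpace ℝ (Fin N)))
    (r φ : EuclideanSpace ℝ (Fin N) → ℝ) : ℝ :=
  sInf {c : ℝ | 0 < c ∧ ∫ x, |φ x / c| ^ r x ∂μ ≤ 1}

section LuxemburgModular

variable {N : ℕ} {μ : Measure (EuclideanSpace ℝ (Fin N))} {r φ : EuclideanSpace ℝ (Fin N) → ℝ}

lemma continuous_abs_div_rpow (hr : Continuous r) (hr1 : ∀ x, 1 ≤ r x) (hφ : Continuous φ)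
    (c : ℝ) : Continuous fun x => |φ x / c| ^ r x :=
  (hφ.div_const c).abs.rpow hr fun x => Or.inr (zero_lt_one.trans_le (hr1 x))

lemma hasCompactSupport_abs_div_rpow (hr1 : ∀ x, 1 ≤ r x) (hφc : HasCompactSupport φ) (c : ℝ) :
    HasCompactSupport fun x => |φ x / c| ^ r x := by
  refine hφc.mono fun x hx h0 => hx ?_
  have : r x ≠ 0 := (zero_lt_one.trans_le (hr1 x)).ne'
  simp [h0, Real.zero_rpow this]

lemma integrable_abs_div_rpow [IsFiniteMeasure μ] (hr : Continuous r) (hr1 : ∀ x, 1 ≤ r x)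
    (hφ : Continuous φ) (hφc : HasCompactSupport φ) (c : ℝ) :
    Integrable (fun x => |φ x / c| ^ r x) μ :=
  (continuous_abs_div_rpow hr hr1 hφ c).integrable_of_hasCompactSupport
    (hasCompactSupport_abs_div_rpow hr1 hφc c)

lemma integral_abs_div_rpow_le [IsFiniteMeasure μ] (hr : Continuous r) (hr1 : ∀ x, 1 ≤ r x)
    (hφ : Continuous φ) (hφc : HasCompactSupport φ) {c d : ℝ} (hd : 0 < d) (hdc : d ≤ c) :
    ∫ x, |φ x / c| ^ r x ∂μ ≤ d / c * ∫ x, |φ x / d| ^ r x ∂μ := by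
  have hc : 0 < c := hd.trans_le hdc
  rw [← integral_const_mul]
  refine integral_mono (integrable_abs_div_rpow hr hr1 hφ hφc c)
    ((integrable_abs_div_rpow hr hr1 hφ hφc d).const_mul _) fun x => ?_
  have hdc0 : 0 < d / c := div_pos hd hc
  have hsplit : |φ x / c| = d / c * |φ x / d| := by
    rw [abs_div, abs_div, abs_of_pos hc, abs_of_pos hd]
    field_simp
  have hle : (d / c) ^ r x ≤ d / c := by
    simpa using Real.rpow_le_rpow_of_exponent_ge hdc0 ((div_le_one hc).2 hdc) (hr1 x)
  change |φ x / c| ^ r x ≤ d / c * |φ x / d| ^ r x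
  rw [hsplit, Real.mul_rpow hdc0.le (abs_nonneg _)]
  gcongr

lemma luxNormM_nonneg : 0 ≤ luxNormM μ r φ :=
  Real.sInf_nonneg fun _ hc => hc.1.le

lemma luxNormM_le {c : ℝ} (hc : 0 < c) (h : ∫ x, |φ x / c| ^ r x ∂μ ≤ 1) :
    luxNormM μ r φ ≤ c :=
  csInf_le ⟨0, fun _ hd => hd.1.le⟩ ⟨hc, h⟩

lemma nonempty_luxNormM_set [IsFiniteMeasure μ] (hr : Continuous r) (hr1 : ∀ x, 1 ≤ r x)
    (hφ : Continuous φ) (hφc : HasCompactSupport φ) :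
    {c : ℝ | 0 < c ∧ ∫ x, |φ x / c| ^ r x ∂μ ≤ 1}.Nonempty := by
  set t := max 1 (∫ x, |φ x / 1| ^ r x ∂μ)
  have ht1 : 1 ≤ t := le_max_left _ _
  have ht0 : 0 < t := zero_lt_one.trans_le ht1
  refine ⟨t, ht0, (integral_abs_div_rpow_le hr hr1 hφ hφc one_pos ht1).trans ?_⟩
  rw [one_div, inv_mul_le_iff₀ ht0, mul_one]
  exact le_max_right _ _

lemma le_luxNormM [IsFiniteMeasure μ] (hr : Continuous r) (hr1 : ∀ x, 1 ≤ r x)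
    (hφ : Continuous φ) (hφc : HasCompactSupport φ) {c : ℝ}
    (h : 1 < ∫ x, |φ x / c| ^ r x ∂μ) : c ≤ luxNormM μ r φ := by
  refine le_csInf (nonempty_luxNormM_set hr hr1 hφ hφc) fun d hd => ?_
  by_contra! hdc
  have hscale := integral_abs_div_rpow_le (μ := μ) hr hr1 hφ hφc hd.1 hdc.le
  have hc : 0 < c := hd.1.trans hdc
  exact (h.trans_le hscale).not_ge
    (mul_le_one₀ ((div_le_one hc).2 hdc.le) (by positivity) hd.2)

lemma integral_abs_div_rpow_lt_one [IsFiniteMeasure μ] (hr : Continuous r) (hr1 : ∀ x, 1 ≤ r x)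
    (hφ : Continuous φ) (hφc : HasCompactSupport φ) {c : ℝ} (h : luxNormM μ r φ < c) :
    ∫ x, |φ x / c| ^ r x ∂μ < 1 := by
  obtain ⟨d, hd, hdc⟩ := exists_lt_of_csInf_lt (nonempty_luxNormM_set hr hr1 hφ hφc) h
  have hc : 0 < c := hd.1.trans hdc
  calc ∫ x, |φ x / c| ^ r x ∂μ
      ≤ d / c * ∫ x, |φ x / d| ^ r x ∂μ := integral_abs_div_rpow_le hr hr1 hφ hφc hd.1 hdc.le
    _ ≤ d / c * 1 := mul_le_mul_of_nonneg_left hd.2 (div_pos hd.1 hc).le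
    _ < 1 := by rwa [mul_one, div_lt_one hc]

end LuxemburgModular

/-- If `ν_n ⇀* ν` in `M(ℝ^N)`, then `|φ|_{L^{r(x)}_{ν_n}} → |φ|_{L^{r(x)}_ν}` for every
continuous compactly supported `φ`. -/
theorem luxNormM_tendsto_of_weakStar
    (N : ℕ) (ν : Measure (EuclideanSpace ℝ (Fin N))) (νn : ℕ → Measure (EuclideanSpace ℝ (Fin N)))
    (hν : IsFiniteMeasure ν) (hνn : ∀ n, IsFiniteMeasure (νn n))
    (hweak : ∀ f : EuclideanSpace ℝ (Fin N) → ℝ, Continuous f →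
      Tendsto f (cocompact (EuclideanSpace ℝ (Fin N))) (nhds 0) →
      Tendsto (fun n => ∫ x, f x ∂(νn n)) atTop (nhds (∫ x, f x ∂ν)))
    (r : EuclideanSpace ℝ (Fin N) → ℝ) (hr : Continuous r)
    (hr1 : 1 < sInf (Set.range r)) (hrbdd : BddAbove (Set.range r))
    (φ : EuclideanSpace ℝ (Fin N) → ℝ) (hφ : Continuous φ) (hφc : HasCompactSupport φ) :
    Tendsto (fun n => luxNormM (νn n) r φ) atTop (nhds (luxNormM ν r φ)) := by
  have hbelow : BddBelow (Set.range r) := by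
    by_contra h
    rw [Real.sInf_of_not_bddBelow h] at hr1
    linarith
  have hr1' : ∀ x, 1 ≤ r x := fun x => hr1.le.trans (csInf_le hbelow ⟨x, rfl⟩)
  have hmod : ∀ c : ℝ, Tendsto (fun n => ∫ x, |φ x / c| ^ r x ∂(νn n)) atTop
      (nhds (∫ x, |φ x / c| ^ r x ∂ν)) := fun c =>
    hweak _ (continuous_abs_div_rpow hr hr1' hφ c)
      (hasCompactSupport_abs_div_rpow hr1' hφc c).is_zero_at_infty
  refine tendsto_order.2 ⟨fun a ha => ?_, fun b hb => ?_⟩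
  · rcases lt_or_ge a 0 with ha0 | ha0
    · exact Eventually.of_forall fun n => ha0.trans_le luxNormM_nonneg
    · obtain ⟨c, hac, hc⟩ := exists_between ha
      have hone : 1 < ∫ x, |φ x / c| ^ r x ∂ν := by
        by_contra! h
        exact hc.not_ge (luxNormM_le (ha0.trans_lt hac) h)
      filter_upwards [(hmod c).eventually_const_lt hone] with n hn
      exact hac.trans_le (le_luxNormM hr hr1' hφ hφc hn)
  · obtain ⟨c, hc, hcb⟩ := exists_between hb
    filter_upwards [(hmod c).eventually_lt_const
      (integral_abs_div_rpow_lt_one hr hr1' hφ hφc hc)] with n hn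
    exact (luxNormM_le (luxNormM_nonneg.trans_lt hc) hn.le).trans_lt hcb
end

section
/- Let ν be a nonnegative finite Borel measure on ℝ^N and suppose there exists a constant C > 0 such that |φ|_{L^{r(x)}_ν(ℝ^N)} ≤ C |φ|_{L^{p(x)}_ν(ℝ^N)} for all φ ∈ C_c^∞(ℝ^N), where p, r : ℝ^N → ℝ are continuous with 1 < inf p ≤ sup p < ∞, 1 < inf r ≤ sup r < ∞, and inf_{ℝ^N}(r − p) > 0. Then there exists δ₀ > 0 such that every open set O ⊆ ℝ^N satisfies either ν(O) = 0 or ν(O) ≥ δ₀. -/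
open MeasureTheory Filter Topology

/-- If `0 ≤ φ ≤ 1` is supported in a set `U` of mass in `(0, 1]` on which the exponent is at most `b`,
then `μ(U) ^ (1 / b)` is admissible in the infimum defining the Luxemburg norm. -/
theorem integral_div_rpow_le_one {N : ℕ} (μ : Measure (EuclideanSpace ℝ (Fin N)))
    [IsFiniteMeasure μ] {q φ : EuclideanSpace ℝ (Fin N) → ℝ}
    {U : Set (EuclideanSpace ℝ (Fin N))} {b : ℝ} (hU : MeasurableSet U) (hb : 0 < b)
    (hq : ∀ x, 0 < q x) (hqb : ∀ x ∈ U, q x ≤ b) (hφ0 : ∀ x, 0 ≤ φ x) (hφ1 : ∀ x, φ x ≤ 1)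
    (hφU : ∀ x ∉ U, φ x = 0) (hm0 : 0 < μ.real U) (hm1 : μ.real U ≤ 1) :
    ∫ x, |φ x / μ.real U ^ (1 / b)| ^ q x ∂μ ≤ 1 := by
  set m := μ.real U with hm
  set c := m ^ (1 / b) with hc
  have hc0 : 0 < c := Real.rpow_pos_of_pos hm0 _
  have hc1 : c ≤ 1 := Real.rpow_le_one hm0.le hm1 (by positivity)
  have hcb : c ^ b = m := by
    rw [hc, ← Real.rpow_mul hm0.le, one_div_mul_cancel hb.ne', Real.rpow_one]
  have hle : ∀ x, |φ x / c| ^ q x ≤ U.indicator (fun _ => m⁻¹) x := by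
    intro x
    by_cases hx : x ∈ U
    · rw [Set.indicator_of_mem hx, abs_of_nonneg (div_nonneg (hφ0 x) hc0.le)]
      calc (φ x / c) ^ q x ≤ (c⁻¹) ^ q x := by
            refine Real.rpow_le_rpow (div_nonneg (hφ0 x) hc0.le) ?_ (hq x).le
            rw [div_eq_mul_inv]
            exact mul_le_of_le_one_left (inv_nonneg.2 hc0.le) (hφ1 x)
        _ ≤ (c⁻¹) ^ b :=
            Real.rpow_le_rpow_of_exponent_le ((one_le_inv₀ hc0).2 hc1) (hqb x hx)
        _ = m⁻¹ := by rw [Real.inv_rpow hc0.le, hcb]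
    · rw [Set.indicator_of_notMem hx, hφU x hx, zero_div, abs_zero,
        Real.zero_rpow (hq x).ne']
  calc ∫ x, |φ x / c| ^ q x ∂μ ≤ ∫ x, U.indicator (fun _ => m⁻¹) x ∂μ :=
        integral_mono_of_nonneg (ae_of_all _ fun x => by positivity)
          ((integrable_const _).indicator hU) (ae_of_all _ hle)
    _ = 1 := by
        rw [integral_indicator_const _ hU, ← hm, smul_eq_mul, mul_inv_cancel₀ hm0.ne']

theorem luxNormM_le_measureReal_rpow {N : ℕ} (μ : Measure (EuclideanSpace ℝ (Fin N)))
    [IsFiniteMeasure μ] {q φ : EuclideanSpace ℝ (Fin N) → ℝ}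
    {U : Set (EuclideanSpace ℝ (Fin N))} {b : ℝ} (hU : MeasurableSet U) (hb : 0 < b)
    (hq : ∀ x, 0 < q x) (hqb : ∀ x ∈ U, q x ≤ b) (hφ0 : ∀ x, 0 ≤ φ x) (hφ1 : ∀ x, φ x ≤ 1)
    (hφU : ∀ x ∉ U, φ x = 0) (hm0 : 0 < μ.real U) (hm1 : μ.real U ≤ 1) :
    luxNormM μ q φ ≤ μ.real U ^ (1 / b) :=
  csInf_le ⟨0, fun _ h => h.1.le⟩ ⟨Real.rpow_pos_of_pos hm0 _,
    integral_div_rpow_le_one μ hU hb hq hqb hφ0 hφ1 hφU hm0 hm1⟩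

/-- If `φ = 1` on a set `K` of mass at most one on which the exponent is at least `a`, then the
Luxemburg norm of `φ` is at least `μ(K) ^ (1 / a)`. -/
theorem measureReal_rpow_le_luxNormM {N : ℕ} (μ : Measure (EuclideanSpace ℝ (Fin N)))
    [IsFiniteMeasure μ] {q φ : EuclideanSpace ℝ (Fin N) → ℝ}
    {K : Set (EuclideanSpace ℝ (Fin N))} {a : ℝ} (hK : MeasurableSet K) (ha : 0 < a)
    (hqc : Continuous q) (hq : ∀ x, 0 < q x) (hqa : ∀ x ∈ K, a ≤ q x)
    (hφc : Continuous φ) (hφs : HasCompactSupport φ) (hφK : ∀ x ∈ K, φ x = 1)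
    (hK1 : μ.real K ≤ 1) (hne : ∃ c : ℝ, 0 < c ∧ ∫ x, |φ x / c| ^ q x ∂μ ≤ 1) :
    μ.real K ^ (1 / a) ≤ luxNormM μ q φ := by
  refine le_csInf hne ?_
  rintro c ⟨hc0, hc⟩
  rcases le_or_gt 1 c with h1 | h1
  · exact (Real.rpow_le_one measureReal_nonneg hK1 (by positivity)).trans h1
  have hint : Integrable (fun x => |φ x / c| ^ q x) μ := by
    refine Continuous.integrable_of_hasCompactSupport ?_ ?_
    · exact (hφc.div_const c).abs.rpow hqc fun x => Or.inr (hq x)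
    · refine hφs.mono fun x hx => ?_
      contrapose! hx
      simp only [Function.mem_support, not_not] at hx ⊢
      rw [hx, zero_div, abs_zero, Real.zero_rpow (hq x).ne']
  have hle : ∀ x, K.indicator (fun _ => (c ^ a)⁻¹) x ≤ |φ x / c| ^ q x := by
    intro x
    by_cases hx : x ∈ K
    · rw [Set.indicator_of_mem hx, hφK x hx, one_div, abs_of_pos (inv_pos.2 hc0),
        ← Real.inv_rpow hc0.le]
      exact Real.rpow_le_rpow_of_exponent_le ((one_le_inv₀ hc0).2 h1.le) (hqa x hx)
    · rw [Set.indicator_of_notMem hx]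
      positivity
  have hca : 0 < c ^ a := Real.rpow_pos_of_pos hc0 a
  have hKc : μ.real K ≤ c ^ a := by
    have h := (integral_mono ((integrable_const _).indicator hK) hint hle).trans hc
    rw [integral_indicator_const _ hK, smul_eq_mul, ← div_eq_mul_inv, div_le_one hca] at h
    exact h
  calc μ.real K ^ (1 / a) ≤ (c ^ a) ^ (1 / a) :=
        Real.rpow_le_rpow measureReal_nonneg hKc (by positivity)
    _ = c := by rw [← Real.rpow_mul hc0.le, mul_one_div_cancel ha.ne', Real.rpow_one]

/-- A mass `m ≤ 1` with `(m / 2) ^ (1 / a) ≤ C m ^ (1 / b)` and `a > b` is bounded below in terms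
of `C` and a lower bound `e` for `1 / b - 1 / a`. -/
theorem rpow_le_of_half_rpow_le {m a b C e : ℝ} (hm0 : 0 < m) (hm1 : m ≤ 1) (ha : 1 ≤ a)
    (hC : 0 < C) (he : 0 < e) (heab : e ≤ 1 / b - 1 / a)
    (h : (m / 2) ^ (1 / a) ≤ C * m ^ (1 / b)) :
    (2 * C)⁻¹ ^ (1 / e) ≤ m := by
  have ha0 : 0 < a := zero_lt_one.trans_le ha
  have h2 : (2 : ℝ) ^ (1 / a) ≤ 2 := by
    calc (2 : ℝ) ^ (1 / a) ≤ 2 ^ (1 : ℝ) :=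
          Real.rpow_le_rpow_of_exponent_le one_le_two ((div_le_one ha0).2 ha)
      _ = 2 := Real.rpow_one 2
  have hma : 0 < m ^ (1 / a) := Real.rpow_pos_of_pos hm0 _
  have hsplit : m ^ (1 / b) = m ^ (1 / a) * m ^ (1 / b - 1 / a) := by
    rw [← Real.rpow_add hm0, add_sub_cancel]
  have hmain : 1 ≤ 2 * C * m ^ (1 / b - 1 / a) := by
    rw [Real.div_rpow hm0.le zero_le_two, div_le_iff₀ (Real.rpow_pos_of_pos two_pos _)] at h
    have h' : m ^ (1 / a) ≤ C * m ^ (1 / b) * 2 :=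
      h.trans (mul_le_mul_of_nonneg_left h2 (by positivity))
    rw [hsplit] at h'
    refine le_of_mul_le_mul_left ?_ hma
    linarith
  have hme : (2 * C)⁻¹ ≤ m ^ e := by
    rw [inv_le_iff_one_le_mul₀' (by positivity)]
    exact hmain.trans (mul_le_mul_of_nonneg_left
      (Real.rpow_le_rpow_of_exponent_ge hm0 hm1 heab) (by positivity))
  calc (2 * C)⁻¹ ^ (1 / e) ≤ (m ^ e) ^ (1 / e) :=
        Real.rpow_le_rpow (by positivity) hme (by positivity)
    _ = m := by rw [← Real.rpow_mul hm0.le, mul_one_div_cancel he.ne', Real.rpow_one]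

theorem sInf_range_le_of_pos {X : Type*} {f : X → ℝ} (h : 0 < sInf (Set.range f)) (x : X) :
    sInf (Set.range f) ≤ f x := by
  refine csInf_le ?_ ⟨x, rfl⟩
  by_contra hb
  rw [Real.sInf_of_not_bddBelow hb] at h
  exact h.false

/-- Under the reverse Hölder inequality, there is a `δ₀ > 0` such that every open set has
`ν`-measure either `0` or at least `δ₀`. -/
theorem measure_open_zero_or_ge_of_reverse_holder
    (N : ℕ) (ν : Measure (EuclideanSpace ℝ (Fin N))) (hν : IsFiniteMeasure ν)
    (p r : EuclideanSpace ℝ (Fin N) → ℝ) (hpc : Continuous p) (hrc : Continuous r)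
    (hp1 : 1 < sInf (Set.range p)) (hpbdd : BddAbove (Set.range p))
    (hr1 : 1 < sInf (Set.range r)) (hrbdd : BddAbove (Set.range r))
    (hgap : 0 < sInf (Set.range (fun x => r x - p x)))
    (C : ℝ) (hC : 0 < C)
    (hineq : ∀ φ : EuclideanSpace ℝ (Fin N) → ℝ, ContDiff ℝ (⊤ : ℕ∞) φ → HasCompactSupport φ →
      luxNormM ν r φ ≤ C * luxNormM ν p φ) :
    ∃ δ₀ : ℝ, 0 < δ₀ ∧
      ∀ O : Set (EuclideanSpace ℝ (Fin N)), IsOpen O →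
        ν O = 0 ∨ ENNReal.ofReal δ₀ ≤ ν O := by
  have hp : ∀ x, 1 < p x := fun x =>
    hp1.trans_le (sInf_range_le_of_pos (zero_lt_one.trans hp1) x)
  have hr : ∀ x, 1 < r x := fun x =>
    hr1.trans_le (sInf_range_le_of_pos (zero_lt_one.trans hr1) x)
  have hg := sInf_range_le_of_pos hgap
  set g := sInf (Set.range (fun x => r x - p x))
  obtain ⟨R, hR⟩ := hrbdd
  replace hR : ∀ x, r x ≤ R := fun x => hR ⟨x, rfl⟩
  have hR0 : 0 < R := zero_lt_one.trans ((hr 0).trans_le (hR 0))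
  set e := g / 2 / (R * R)
  have he : 0 < e := by positivity
  refine ⟨min 1 ((2 * C)⁻¹ ^ (1 / e)), by positivity, fun O hO => ?_⟩
  by_cases hO0 : ν O = 0
  · exact Or.inl hO0
  right
  obtain ⟨x₀, hx₀, hpos⟩ := exists_mem_forall_mem_nhdsWithin_pos_measure hO0
  rw [hO.nhdsWithin_eq hx₀] at hpos
  set a := r x₀ - g / 4 with ha
  set b := p x₀ + g / 4 with hb
  have hgx : g ≤ r x₀ - p x₀ := hg x₀
  have hb1 : 1 < b := by linarith [hp x₀]
  have hab : g / 2 ≤ a - b := by linarith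
  have haR : a ≤ R := by linarith [hR x₀]
  have hnhds : ∀ᶠ x in 𝓝 x₀, x ∈ O ∧ a ≤ r x ∧ p x ≤ b :=
    (hO.eventually_mem hx₀).and
      ((hrc.continuousAt.eventually_const_le (by linarith)).and
        (hpc.continuousAt.eventually_le_const (by linarith)))
  obtain ⟨ρ, hρ, hball⟩ := Metric.eventually_nhds_iff_ball.1 hnhds
  have hUpos : 0 < ν (Metric.ball x₀ ρ) := hpos _ (Metric.ball_mem_nhds x₀ hρ)
  have hU0 : 0 < ν.real (Metric.ball x₀ ρ) :=
    ENNReal.toReal_pos hUpos.ne' (measure_ne_top _ _)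
  have hUO : ν (Metric.ball x₀ ρ) ≤ ν O := measure_mono fun x hx => (hball x hx).1
  refine le_trans ?_ hUO
  rw [← ofReal_measureReal]
  refine ENNReal.ofReal_le_ofReal ?_
  rcases le_or_gt 1 (ν.real (Metric.ball x₀ ρ)) with h1 | h1
  · exact (min_le_left _ _).trans h1
  refine (min_le_right _ _).trans ?_
  obtain ⟨K, hKU, hK, hKm⟩ := Metric.isOpen_ball.exists_lt_isCompact
    (ENNReal.half_lt_self hUpos.ne' (measure_ne_top ν _))
  have hKm' : ν.real (Metric.ball x₀ ρ) / 2 ≤ ν.real K := by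
    have := ENNReal.toReal_mono (measure_ne_top ν K) hKm.le
    simpa [measureReal_def] using this
  obtain ⟨ρ', ⟨hρ'0, hρ'⟩, hKρ'⟩ := exists_pos_lt_subset_ball hρ hK.isClosed hKU
  let φ : ContDiffBump x₀ := ⟨ρ', ρ, hρ'0, hρ'⟩
  have hφK : ∀ x ∈ K, φ x = 1 := fun x hx =>
    φ.one_of_mem_closedBall (Metric.ball_subset_closedBall (hKρ' hx))
  have hφU : ∀ x ∉ Metric.ball x₀ ρ, φ x = 0 := fun x hx =>
    φ.zero_of_le_dist (not_lt.1 hx)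
  have hr0 : ∀ x, 0 < r x := fun x => zero_lt_one.trans (hr x)
  have hp0 : ∀ x, 0 < p x := fun x => zero_lt_one.trans (hp x)
  have hne : ∃ c : ℝ, 0 < c ∧ ∫ x, |φ x / c| ^ r x ∂ν ≤ 1 :=
    ⟨_, Real.rpow_pos_of_pos hU0 _, integral_div_rpow_le_one ν measurableSet_ball hR0 hr0
      (fun x _ => hR x) (fun _ => φ.nonneg) (fun _ => φ.le_one) hφU hU0 h1.le⟩
  have hupper := luxNormM_le_measureReal_rpow ν measurableSet_ball (by linarith) hp0
    (fun x hx => (hball x hx).2.2) (fun _ => φ.nonneg) (fun _ => φ.le_one) hφU hU0 h1.le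
  have hlower := measureReal_rpow_le_luxNormM ν hK.measurableSet (a := a) (by linarith) hrc hr0
    (fun x hx => (hball x (hKU hx)).2.1) φ.continuous φ.hasCompactSupport hφK
    ((measureReal_mono hKU).trans h1.le) hne
  have ha0 : 0 < a := by linarith
  have hb0 : 0 < b := by linarith
  refine rpow_le_of_half_rpow_le hU0 h1.le (a := a) (b := b) (by linarith) hC he ?_ ?_
  · rw [div_sub_div _ _ hb0.ne' ha0.ne', one_mul, mul_one]
    refine div_le_div₀ (by linarith) hab (mul_pos hb0 ha0) ?_
    exact mul_le_mul (by linarith) haR ha0.le hR0.le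
  · calc (ν.real (Metric.ball x₀ ρ) / 2) ^ (1 / a) ≤ ν.real K ^ (1 / a) :=
          Real.rpow_le_rpow (by positivity) hKm' (by positivity)
      _ ≤ luxNormM ν r φ := hlower
      _ ≤ C * luxNormM ν p φ := hineq φ φ.contDiff φ.hasCompactSupport
      _ ≤ C * ν.real (Metric.ball x₀ ρ) ^ (1 / b) := mul_le_mul_of_nonneg_left hupper hC.le
end

section
/- Let r : ℝ^N → ℝ be continuous with 1 < inf r ≤ sup r < ∞, let m : ℝ^N → ℝ be measurable and positive a.e., and let {f_n} be a sequence of measurable functions on ℝ^N with sup_n ∫_{ℝ^N} m(x)|f_n(x)|^{r(x)} dx < ∞ (i.e. {f_n} is bounded in L^{r(x)}(m,ℝ^N)) and f_n(x) → f(x) for a.e. x ∈ ℝ^N. Then ∫_{ℝ^N} m(x)|f(x)|^{r(x)} dx < ∞ (i.e. f ∈ L^{r(x)}(m,ℝ^N)) and lim_{n→∞} ∫_{ℝ^N} | m(x)|f_n(x)|^{r(x)} − m(x)|f_n(x) − f(x)|^{r(x)} − m(x)|f(x)|^{r(x)} | dx = 0. -/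
open MeasureTheory Filter Topology

/-- For small `δ`, perturbing the base `1` by at most `δ` changes the `R`-th power by at most `ε`. -/
lemma exists_perturbation_rpow (R : ℝ) {ε : ℝ} (hε : 0 < ε) :
    ∃ δ : ℝ, 0 < δ ∧ δ < 1 ∧ (1 + δ) ^ R ≤ 1 + ε ∧ 1 - ε ≤ (1 - δ) ^ R := by
  have hp : Tendsto (fun δ : ℝ => (1 + δ) ^ R) (𝓝[>] 0) (𝓝 1) := by
    have : ContinuousAt (fun δ : ℝ => (1 + δ) ^ R) 0 :=
      ContinuousAt.rpow_const (by fun_prop) (Or.inl (by norm_num))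
    simpa using this.tendsto.mono_left nhdsWithin_le_nhds
  have hm : Tendsto (fun δ : ℝ => (1 - δ) ^ R) (𝓝[>] 0) (𝓝 1) := by
    have : ContinuousAt (fun δ : ℝ => (1 - δ) ^ R) 0 :=
      ContinuousAt.rpow_const (by fun_prop) (Or.inl (by norm_num))
    simpa using this.tendsto.mono_left nhdsWithin_le_nhds
  obtain ⟨δ, h1, h2, h3⟩ := ((hp.eventually_le_const (by linarith : 1 < 1 + ε)).and
    ((hm.eventually_const_le (by linarith : 1 - ε < 1)).and
      (Ioo_mem_nhdsGT (zero_lt_one' ℝ)))).exists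
  exact ⟨δ, h3.1, h3.2, h1, h2⟩

/-- The Brezis–Lieb pointwise inequality, with a constant uniform for exponents in `(0, R]`. -/
lemma exists_abs_rpow_add_sub_le (R : ℝ) {ε : ℝ} (hε : 0 < ε) :
    ∃ C : ℝ, ∀ p : ℝ, 0 < p → p ≤ R → ∀ a b : ℝ,
      |(|a + b| ^ p - |a| ^ p - |b| ^ p)| ≤ ε * |a| ^ p + C * |b| ^ p := by
  obtain ⟨δ, hδ, hδ1, hup, hlow⟩ := exists_perturbation_rpow R hε
  refine ⟨(1 + δ⁻¹) ^ R + (δ⁻¹) ^ R + 1, fun p hp hpR a b => ?_⟩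
  have hδi : 1 ≤ δ⁻¹ := (one_le_inv₀ hδ).2 hδ1.le
  have ha := abs_nonneg a
  have hb := abs_nonneg b
  have hap : 0 ≤ |a| ^ p := by positivity
  have hbp : 0 ≤ |b| ^ p := by positivity
  have habp : 0 ≤ |a + b| ^ p := by positivity
  have hC1 : 0 ≤ (1 + δ⁻¹) ^ R := by positivity
  have hC2 : 0 ≤ (δ⁻¹) ^ R := by positivity
  rcases le_or_gt (δ * |a|) |b| with hab | hab
  · have hle : |a| ≤ δ⁻¹ * |b| := by
      rw [inv_mul_eq_div, le_div_iff₀ hδ]; linarith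
    have h1 : |a| ^ p ≤ (δ⁻¹) ^ R * |b| ^ p := calc
      |a| ^ p ≤ (δ⁻¹ * |b|) ^ p := Real.rpow_le_rpow ha hle hp.le
      _ = (δ⁻¹) ^ p * |b| ^ p := Real.mul_rpow (by positivity) hb
      _ ≤ _ := by
        gcongr
    have h2 : |a + b| ^ p ≤ (1 + δ⁻¹) ^ R * |b| ^ p := calc
      |a + b| ^ p ≤ ((1 + δ⁻¹) * |b|) ^ p :=
        Real.rpow_le_rpow (abs_nonneg _) (by linarith [abs_add_le a b]) hp.le
      _ = (1 + δ⁻¹) ^ p * |b| ^ p := Real.mul_rpow (by positivity) hb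
      _ ≤ _ := by
        gcongr
        linarith
    have : 0 ≤ ε * |a| ^ p := by positivity
    rw [abs_le]
    constructor <;> nlinarith
  · have h1 : |a + b| ^ p ≤ (1 + ε) * |a| ^ p := calc
      |a + b| ^ p ≤ ((1 + δ) * |a|) ^ p :=
        Real.rpow_le_rpow (abs_nonneg _) (by linarith [abs_add_le a b]) hp.le
      _ = (1 + δ) ^ p * |a| ^ p := Real.mul_rpow (by positivity) ha
      _ ≤ (1 + ε) * |a| ^ p := by
        gcongr
        exact (Real.rpow_le_rpow_of_exponent_le (by linarith) hpR).trans hup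
    have h2 : (1 - ε) * |a| ^ p ≤ |a + b| ^ p := calc
      (1 - ε) * |a| ^ p ≤ (1 - δ) ^ p * |a| ^ p := by
        gcongr
        exact hlow.trans
          (Real.rpow_le_rpow_of_exponent_ge (by linarith) (by linarith) hpR)
      _ = ((1 - δ) * |a|) ^ p := (Real.mul_rpow (by linarith) ha).symm
      _ ≤ |a + b| ^ p := by
        refine Real.rpow_le_rpow (mul_nonneg (by linarith) ha) ?_ hp.le
        have := abs_sub_abs_le_abs_sub a (-b)
        rw [abs_neg, sub_neg_eq_add] at this
        linarith
    have : 0 ≤ ((1 + δ⁻¹) ^ R + (δ⁻¹) ^ R) * |b| ^ p := by positivity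
    rw [abs_le]
    constructor <;> nlinarith

/-- Quasi-subadditivity of `|·| ^ p`, with a constant uniform for exponents in `(0, R]`. -/
lemma abs_sub_rpow_le {p R : ℝ} (hp : 0 < p) (hpR : p ≤ R) (a b : ℝ) :
    |a - b| ^ p ≤ 2 ^ R * (|a| ^ p + |b| ^ p) := calc
  |a - b| ^ p ≤ (2 * max |a| |b|) ^ p := by
    refine Real.rpow_le_rpow (abs_nonneg _) ?_ hp.le
    linarith [abs_sub a b, le_max_left |a| |b|, le_max_right |a| |b|]
  _ = 2 ^ p * max |a| |b| ^ p :=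
    Real.mul_rpow (by norm_num) ((abs_nonneg a).trans (le_max_left _ _))
  _ ≤ 2 ^ R * (|a| ^ p + |b| ^ p) := by
    have ha : 0 ≤ |a| ^ p := by positivity
    have hb : 0 ≤ |b| ^ p := by positivity
    gcongr
    · norm_num
    · rcases max_choice |a| |b| with h | h <;> rw [h] <;> linarith

section

variable {α : Type*} [MeasurableSpace α] {μ : Measure α} {r m : α → ℝ} {f : ℕ → α → ℝ}
  {f₀ : α → ℝ}

/-- Fatou's lemma for the weighted variable exponent modular. -/
lemma lintegral_modular_le_of_tendsto (hr : Measurable r) (hrpos : ∀ x, 0 < r x)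
    (hm : Measurable m) (hf : ∀ n, Measurable (f n)) {M : ENNReal}
    (hbdd : ∀ n, ∫⁻ x, ENNReal.ofReal (m x * |f n x| ^ r x) ∂μ ≤ M)
    (hae : ∀ᵐ x ∂μ, Tendsto (fun n => f n x) atTop (𝓝 (f₀ x))) :
    ∫⁻ x, ENNReal.ofReal (m x * |f₀ x| ^ r x) ∂μ ≤ M := calc
  _ = ∫⁻ x, liminf (fun n => ENNReal.ofReal (m x * |f n x| ^ r x)) atTop ∂μ := by
    refine lintegral_congr_ae ?_
    filter_upwards [hae] with x hx
    exact (ENNReal.tendsto_ofReal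
      ((hx.abs.rpow_const (Or.inr (hrpos x).le)).const_mul (m x))).liminf_eq.symm
  _ ≤ liminf (fun n => ∫⁻ x, ENNReal.ofReal (m x * |f n x| ^ r x) ∂μ) atTop :=
    lintegral_liminf_le fun n => by have := hf n; fun_prop
  _ ≤ M := liminf_le_of_le (by isBoundedDefault) fun b hb => by
    obtain ⟨n, hn⟩ := hb.exists
    exact hn.trans (hbdd n)

/-- The Brezis–Lieb lemma for a weighted variable exponent modular on a measure space. -/
lemma tendsto_integral_abs_modular_sub (hr : Measurable r) (hrpos : ∀ x, 0 < r x) {R : ℝ}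
    (hrR : ∀ x, r x ≤ R) (hm : Measurable m) (hmpos : ∀ᵐ x ∂μ, 0 ≤ m x)
    (hf : ∀ n, Measurable (f n)) (hf₀ : Measurable f₀) {M : ℝ}
    (hint : ∀ n, Integrable (fun x => m x * |f n x| ^ r x) μ)
    (hint₀ : Integrable (fun x => m x * |f₀ x| ^ r x) μ)
    (hbdd : ∀ n, ∫ x, m x * |f n x| ^ r x ∂μ ≤ M)
    (hae : ∀ᵐ x ∂μ, Tendsto (fun n => f n x) atTop (𝓝 (f₀ x))) :
    Tendsto (fun n => ∫ x,
      |m x * |f n x| ^ r x - m x * |f n x - f₀ x| ^ r x - m x * |f₀ x| ^ r x| ∂μ)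
      atTop (𝓝 0) := by
  set F : ℕ → α → ℝ := fun n x =>
    |m x * |f n x| ^ r x - m x * |f n x - f₀ x| ^ r x - m x * |f₀ x| ^ r x| with hF
  set G : ℕ → α → ℝ := fun n x => m x * |f n x - f₀ x| ^ r x with hG
  have hG_le : ∀ n, ∀ᵐ x ∂μ,
      G n x ≤ 2 ^ R * (m x * |f n x| ^ r x + m x * |f₀ x| ^ r x) := fun n => by
    filter_upwards [hmpos] with x hx
    calc G n x ≤ m x * (2 ^ R * (|f n x| ^ r x + |f₀ x| ^ r x)) :=
          mul_le_mul_of_nonneg_left (abs_sub_rpow_le (hrpos x) (hrR x) _ _) hx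
      _ = _ := by ring
  have hG_nonneg : ∀ n, ∀ᵐ x ∂μ, 0 ≤ G n x := fun n => by
    filter_upwards [hmpos] with x hx
    positivity
  have hG_int : ∀ n, Integrable (G n) μ := fun n => by
    refine (((hint n).add hint₀).const_mul (2 ^ R)).mono' ?_ ?_
    · have := hf n
      exact Measurable.aestronglyMeasurable (by fun_prop)
    · filter_upwards [hG_le n, hG_nonneg n] with x h1 h2
      rwa [Real.norm_of_nonneg h2]
  have hF_int : ∀ n, Integrable (F n) μ := fun n => (((hint n).sub (hG_int n)).sub hint₀).abs
  set K : ℝ := 2 ^ R * (M + ∫ x, m x * |f₀ x| ^ r x ∂μ) with hK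
  have hG_bdd : ∀ n, ∫ x, G n x ∂μ ≤ K := fun n => by
    refine (integral_mono_ae (hG_int n) (((hint n).add hint₀).const_mul (2 ^ R))
      (hG_le n)).trans ?_
    simp only [Pi.add_apply]
    rw [integral_const_mul, integral_add (hint n) hint₀, hK]
    gcongr
    exact hbdd n
  have hK0 : 0 ≤ K := (integral_nonneg_of_ae (hG_nonneg 0)).trans (hG_bdd 0)
  have hF_tendsto : ∀ᵐ x ∂μ, Tendsto (fun n => F n x) atTop (𝓝 0) := by
    filter_upwards [hae] with x hx
    have h1 := (hx.abs.rpow_const (p := r x) (Or.inr (hrpos x).le)).const_mul (m x)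
    have h2 := ((hx.sub_const (f₀ x)).abs.rpow_const (p := r x)
      (Or.inr (hrpos x).le)).const_mul (m x)
    have h3 := ((h1.sub h2).sub_const (m x * |f₀ x| ^ r x)).abs
    simpa [Real.zero_rpow (hrpos x).ne'] using h3
  refine (tendsto_order.2 ⟨fun a ha => Eventually.of_forall fun n =>
    ha.trans_le (integral_nonneg fun x => abs_nonneg _), fun η hη => ?_⟩)
  set ε : ℝ := η / (2 * (K + 1)) with hε_def
  have hε : 0 < ε := by positivity
  obtain ⟨C, hC⟩ := exists_abs_rpow_add_sub_le R hε
  have hW_le : ∀ n, ∀ᵐ x ∂μ, max (F n x - ε * G n x) 0 ≤ |C| * (m x * |f₀ x| ^ r x) :=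
    fun n => by
    filter_upwards [hmpos] with x hx
    have h := mul_le_mul_of_nonneg_left
      (hC (r x) (hrpos x) (hrR x) (f n x - f₀ x) (f₀ x)) hx
    rw [sub_add_cancel, ← abs_of_nonneg hx, ← abs_mul, abs_of_nonneg hx, mul_sub, mul_sub] at h
    have h0 : 0 ≤ m x * |f₀ x| ^ r x := by positivity
    refine max_le ?_ (by positivity)
    have h1 := mul_le_mul_of_nonneg_right (le_abs_self C) h0
    simp only [hF, hG]
    linarith
  have hW_int : ∀ n, Integrable (fun x => max (F n x - ε * G n x) 0) μ := fun n =>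
    ((hF_int n).sub ((hG_int n).const_mul ε)).sup (integrable_zero _ _ _)
  have hW_tendsto : Tendsto (fun n => ∫ x, max (F n x - ε * G n x) 0 ∂μ) atTop (𝓝 0) := by
    suffices Tendsto (fun n => ∫ x, max (F n x - ε * G n x) 0 ∂μ) atTop
        (𝓝 (∫ _, (0 : ℝ) ∂μ)) by rwa [integral_zero] at this
    refine tendsto_integral_of_dominated_convergence (fun x => |C| * (m x * |f₀ x| ^ r x))
      (fun n => (hW_int n).1) (hint₀.const_mul _) (fun n => ?_) ?_
    · filter_upwards [hW_le n] with x hx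
      rwa [Real.norm_of_nonneg (le_max_right _ _)]
    · filter_upwards [hF_tendsto, hmpos] with x hx hmx
      refine squeeze_zero (fun n => le_max_right _ _) (fun n => ?_) hx
      refine max_le ?_ (abs_nonneg _)
      have : 0 ≤ ε * G n x := by positivity
      linarith
  have hεK : ε * K < η / 2 := by
    rw [hε_def, div_mul_eq_mul_div, div_lt_div_iff₀ (by positivity) (by norm_num)]
    nlinarith
  filter_upwards [hW_tendsto.eventually_lt_const (half_pos hη)] with n hn
  calc ∫ x, F n x ∂μ ≤ ∫ x, (max (F n x - ε * G n x) 0 + ε * G n x) ∂μ :=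
        integral_mono (hF_int n) ((hW_int n).add ((hG_int n).const_mul ε)) fun x => by
          simp only
          linarith [le_max_left (F n x - ε * G n x) 0]
    _ = ∫ x, max (F n x - ε * G n x) 0 ∂μ + ε * ∫ x, G n x ∂μ := by
        rw [integral_add (hW_int n) ((hG_int n).const_mul ε), integral_const_mul]
    _ < η := by
        have := mul_le_mul_of_nonneg_left (hG_bdd n) hε.le
        linarith

end

/-- Brezis–Lieb type lemma in the weighted variable exponent Lebesgue space
`L^{r(x)}(m,ℝ^N)`. -/
theorem brezis_lieb_variable_exponent
    (N : ℕ) (r m : EuclideanSpace ℝ (Fin N) → ℝ)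
    (hrc : Continuous r) (hr1 : 1 < sInf (Set.range r)) (hrbdd : BddAbove (Set.range r))
    (hm : Measurable m) (hmpos : ∀ᵐ x ∂(volume : Measure (EuclideanSpace ℝ (Fin N))), 0 < m x)
    (f : ℕ → EuclideanSpace ℝ (Fin N) → ℝ) (f₀ : EuclideanSpace ℝ (Fin N) → ℝ)
    (hfn : ∀ n, Measurable (f n)) (hf₀ : Measurable f₀)
    (hbdd : ∃ M : ℝ, ∀ n, (∫⁻ x, ENNReal.ofReal (m x * |f n x| ^ r x)) ≤ ENNReal.ofReal M)
    (hae : ∀ᵐ x ∂(volume : Measure (EuclideanSpace ℝ (Fin N))),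
      Tendsto (fun n => f n x) atTop (nhds (f₀ x))) :
    (∫⁻ x, ENNReal.ofReal (m x * |f₀ x| ^ r x)) < ⊤ ∧
      Tendsto (fun n => ∫ x,
          |m x * |f n x| ^ r x - m x * |f n x - f₀ x| ^ r x - m x * |f₀ x| ^ r x|)
        atTop (nhds 0) := by
  obtain ⟨M, hM⟩ := hbdd
  obtain ⟨R, hR⟩ := hrbdd
  have hrR : ∀ x, r x ≤ R := fun x => hR ⟨x, rfl⟩
  have hbelow : BddBelow (Set.range r) := by
    by_contra h
    rw [Real.sInf_of_not_bddBelow h] at hr1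
    linarith
  have hrpos : ∀ x, 0 < r x := fun x => by
    linarith [csInf_le hbelow (Set.mem_range_self x)]
  have hr := hrc.measurable
  have hnonneg : ∀ g : EuclideanSpace ℝ (Fin N) → ℝ,
      0 ≤ᵐ[volume] fun x => m x * |g x| ^ r x := fun g => by
    filter_upwards [hmpos] with x hx
    exact mul_nonneg hx.le (Real.rpow_nonneg (abs_nonneg _) _)
  have hmeas : ∀ g : EuclideanSpace ℝ (Fin N) → ℝ, Measurable g →
      AEStronglyMeasurable (fun x => m x * |g x| ^ r x) volume := fun g hg =>
    Measurable.aestronglyMeasurable (by fun_prop)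
  have hfin : ∫⁻ x, ENNReal.ofReal (m x * |f₀ x| ^ r x) < ⊤ :=
    (lintegral_modular_le_of_tendsto hr hrpos hm hfn hM hae).trans_lt ENNReal.ofReal_lt_top
  refine ⟨hfin, tendsto_integral_abs_modular_sub (M := max M 0) hr hrpos hrR hm
    (hmpos.mono fun x hx => hx.le) hfn hf₀ (fun n => ?_) ?_ (fun n => ?_) hae⟩
  · exact (lintegral_ofReal_ne_top_iff_integrable (hmeas _ (hfn n)) (hnonneg _)).1
      ((hM n).trans_lt ENNReal.ofReal_lt_top).ne
  · exact (lintegral_ofReal_ne_top_iff_integrable (hmeas _ hf₀) (hnonneg _)).1 hfin.ne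
  · rw [integral_eq_lintegral_of_nonneg_ae (hnonneg _) (hmeas _ (hfn n))]
    refine (ENNReal.toReal_mono ENNReal.ofReal_ne_top (hM n)).trans ?_
    rw [ENNReal.toReal_ofReal']
end

section
/- Assume conditions (𝒫) and (𝒞) (the latter in the case Ω = ∅, which the paper explicitly includes). Then there exists a constant C > 0 such that |u|_{L^{q(x)}(b,ℝ^N)} ≤ C ‖u‖ for all u ∈ C_c^∞(ℝ^N); since the space X is defined as the closure of C_c^∞(ℝ^N) in the weighted Sobolev norm ‖·‖, this is precisely the continuous imbedding X ↪ L^{q(x)}(b,ℝ^N). -/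
open MeasureTheory Filter Topology

/-- The critical Sobolev exponent `p*(x) = N p(x)/(N - p(x))`. -/
noncomputable def pstar (N : ℕ) (p : EuclideanSpace ℝ (Fin N) → ℝ)
    (x : EuclideanSpace ℝ (Fin N)) : ℝ :=
  N * p x / (N - p x)

/-- The Luxemburg norm `|u|_{L^{p(x)}(w,ℝ^N)}` on the weighted variable exponent
Lebesgue space over `ℝ^N`. -/
noncomputable def luxNormW {N : ℕ} (w p u : EuclideanSpace ℝ (Fin N) → ℝ) : ℝ :=
  sInf {c : ℝ | 0 < c ∧ ∫ x, w x * |u x / c| ^ p x ≤ 1}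

/-- The weighted variable exponent Sobolev norm
`‖u‖ = ||∇u||_{L^{p(x)}(ℝ^N)} + |u|_{L^{p(x)}(V,ℝ^N)}`. -/
noncomputable def sobNorm {N : ℕ} (p V u : EuclideanSpace ℝ (Fin N) → ℝ) : ℝ :=
  luxNormW (fun _ => 1) p (fun x => ‖fderiv ℝ u x‖) + luxNormW V p u

/-- Condition (𝒫) on the exponent `p` and the potential `V`. -/
structure CondP (N : ℕ) (p V : EuclideanSpace ℝ (Fin N) → ℝ) : Prop where
  lip : ∃ K : NNReal, LipschitzWith K p
  pbddBelow : BddBelow (Set.range p)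
  pbddAbove : BddAbove (Set.range p)
  inf_gt_one : 1 < sInf (Set.range p)
  sup_lt_N : sSup (Set.range p) < N
  Vmeas : Measurable V
  Vpos : ∀ᵐ x ∂(volume : Measure (EuclideanSpace ℝ (Fin N))), 0 < V x
  Vloc : ∀ R : ℝ, 0 < R → ∃ c C : ℝ, 0 < c ∧
    ∀ᵐ x ∂(volume.restrict (Metric.ball (0 : EuclideanSpace ℝ (Fin N)) R)),
      c ≤ V x ∧ V x ≤ C
  logHolderDecay : essInf V (volume : Measure (EuclideanSpace ℝ (Fin N))) = 0 →
    ∃ pinf C₀ : ℝ, ∀ x, |p x - pinf| ≤ C₀ / Real.log (Real.exp 1 + ‖x‖)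

/-- Condition (𝒞) (in the case `Ω = ∅`) on the exponent `q` and the weight `b`. -/
structure CondC (N : ℕ) (p V q b : EuclideanSpace ℝ (Fin N) → ℝ) : Prop where
  qcont : Continuous q
  q_le_pstar : ∀ x, q x ≤ pstar N p x
  gap : 0 < sInf (Set.range (fun x => q x - p x))
  crit_nonempty : {x : EuclideanSpace ℝ (Fin N) | q x = pstar N p x}.Nonempty
  noncrit_finite : essInf V (volume : Measure (EuclideanSpace ℝ (Fin N))) = 0 →
    volume {x : EuclideanSpace ℝ (Fin N) | q x ≠ pstar N p x} < ⊤
  bmeas : Measurable b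
  bbound : ∃ b₀ : ℝ, 0 < b₀ ∧
    ∀ᵐ x ∂(volume : Measure (EuclideanSpace ℝ (Fin N))), 0 < b x ∧ b x ≤ b₀

/-- Condition (𝒮) on the exponent `r` and the weight `a`. -/
structure CondS (N : ℕ) (p r a : EuclideanSpace ℝ (Fin N) → ℝ) : Prop where
  rcont : Continuous r
  rbddAbove : BddAbove (Set.range r)
  inf_gt_one : 1 < sInf (Set.range r)
  gap : 0 < sInf (Set.range (fun x => pstar N p x - r x))
  ameas : Measurable a
  apos : ∀ᵐ x ∂(volume : Measure (EuclideanSpace ℝ (Fin N))), 0 < a x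
  aint : (∫⁻ x, ENNReal.ofReal (a x ^ (pstar N p x / (pstar N p x - r x)))) < ⊤

/-- The Young inequality with a parameter. -/
lemma rpow_mul_le_add_of_pos {X Y r ε : ℝ} (hX : 0 ≤ X) (hY : 0 ≤ Y) (hr : 1 < r) (hε : 0 < ε) :
    X ^ (1 - 1 / r) * Y ≤ ε * X + ε ^ (1 - r) * Y ^ r := by
  have hr0 : 0 < r := by linarith
  have hXr : 0 ≤ X ^ (1 / r) := Real.rpow_nonneg hX _
  have hpow : X ^ (1 - 1 / r) = (X ^ (1 / r)) ^ (r - 1) := by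
    rw [← Real.rpow_mul hX]; congr 1; field_simp
  rcases le_or_gt Y (ε * X ^ (1 / r)) with h | h
  · have h1 : X ^ (1 - 1 / r) * X ^ (1 / r) = X := by
      rcases hX.eq_or_lt with h0 | h0
      · rw [← h0, Real.zero_rpow (by positivity : (1 / r) ≠ 0), mul_zero]
      · rw [← Real.rpow_add h0]; simp
    calc X ^ (1 - 1 / r) * Y ≤ X ^ (1 - 1 / r) * (ε * X ^ (1 / r)) := by gcongr
      _ = ε * X := by rw [mul_left_comm, h1]
      _ ≤ _ := le_add_of_nonneg_right (by positivity)
  · have h1 : X ^ (1 / r) ≤ Y / ε := by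
      rw [le_div_iff₀ hε]; linarith
    have hY0 : 0 < Y := lt_of_le_of_lt (by positivity) h
    calc X ^ (1 - 1 / r) * Y ≤ (Y / ε) ^ (r - 1) * Y := by
          rw [hpow]
          have : (X ^ (1 / r)) ^ (r - 1) ≤ (Y / ε) ^ (r - 1) :=
            Real.rpow_le_rpow hXr h1 (by linarith)
          gcongr
      _ = ε ^ (1 - r) * Y ^ r := by
          rw [Real.div_rpow hY hε.le, show (1 - r) = -(r - 1) by ring, Real.rpow_neg hε.le]
          have : Y ^ r = Y ^ (r - 1) * Y := by
            rw [← Real.rpow_add_one hY0.ne']; ring_nf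
          rw [this]; ring
      _ ≤ _ := le_add_of_nonneg_left (by positivity)

/-- Absorption: a self-improving estimate for `B` yields an a priori bound. -/
lemma exists_bound_of_absorb {n R c D a l : ℝ} (hR : 1 < R) (hRn : R < n) (hc : 0 ≤ c)
    (ha : 0 ≤ a) (hl : 0 ≤ l) :
    ∃ δ C : ℝ, 0 < δ ∧ 0 ≤ C ∧ ∀ B J Λ : ℝ, 0 ≤ B → 0 ≤ J → Λ ≤ δ ^ n →
      B ≤ c * J ^ (n / (n - 1)) + D →
      (∀ ε η : ℝ, 0 < ε → ε ≤ 1 → 0 < η →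
        J ≤ a * (ε * B + ε ^ (1 - R)) + l * (η * B + η ^ (1 - n) * Λ)) → B ≤ C := by
  have hn : 1 < n := by linarith
  set κ : ℝ := (2 * c) ^ (1 - 1 / n) with hκ
  have hκ0 : 0 ≤ κ := by positivity
  have hgap : 0 < 1 / R - 1 / n := by
    rw [sub_pos]; exact one_div_lt_one_div_of_lt (by linarith) hRn
  refine ⟨1 / (4 * κ * l + 1), max (max 1 (2 * D)) ((4 * κ * a) ^ (1 / (1 / R - 1 / n))),
    by positivity, by positivity, ?_⟩
  intro B J Λ hB hJ hΛ hBJ hJB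
  set δ : ℝ := 1 / (4 * κ * l + 1) with hδ
  have hδ0 : 0 < δ := by positivity
  have hδl : κ * (l * (2 * δ)) ≤ 1 / 2 := by
    rw [hδ]
    have : κ * (l * (2 * (1 / (4 * κ * l + 1)))) = (2 * κ * l) / (4 * κ * l + 1) := by ring
    rw [this, div_le_iff₀ (by positivity)]; nlinarith [mul_nonneg hκ0 hl]
  rcases le_or_gt B 1 with hB1 | hB1
  · exact hB1.trans ((le_max_left _ _).trans (le_max_left _ _))
  rcases le_or_gt (c * J ^ (n / (n - 1))) D with hcase | hcase
  · exact (by linarith : B ≤ 2 * D).trans ((le_max_right _ _).trans (le_max_left _ _))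
  refine le_trans ?_ (le_max_right _ _)
  have hB0 : 0 < B := by linarith
  have h1 : B ^ (1 - 1 / n) ≤ κ * J := by
    have h2 : B ≤ 2 * c * J ^ (n / (n - 1)) := by linarith
    have hn1 : 0 ≤ 1 - 1 / n := by
      rw [sub_nonneg, div_le_one (by linarith)]; linarith
    calc B ^ (1 - 1 / n) ≤ (2 * c * J ^ (n / (n - 1))) ^ (1 - 1 / n) :=
          Real.rpow_le_rpow hB h2 hn1
      _ = κ * J := by
          rw [Real.mul_rpow (by positivity) (by positivity), ← Real.rpow_mul hJ]
          have : n / (n - 1) * (1 - 1 / n) = 1 := by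
            have : n - 1 ≠ 0 := by linarith
            field_simp
          rw [this, Real.rpow_one]
  have hε := hJB (B ^ (-(1 / R))) (δ * B ^ (-(1 / n))) (by positivity)
    (Real.rpow_le_one_of_one_le_of_nonpos hB1.le (by
      have : 0 < 1 / R := by positivity
      linarith)) (by positivity)
  have e1 : B ^ (-(1 / R)) * B = B ^ (1 - 1 / R) := by
    rw [← Real.rpow_add_one hB0.ne']; ring_nf
  have e2 : (B ^ (-(1 / R))) ^ (1 - R) = B ^ (1 - 1 / R) := by
    rw [← Real.rpow_mul hB]; congr 1; field_simp; ring
  have e3 : δ * B ^ (-(1 / n)) * B = δ * B ^ (1 - 1 / n) := by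
    rw [mul_assoc, ← Real.rpow_add_one hB0.ne']; ring_nf
  have e4 : (δ * B ^ (-(1 / n))) ^ (1 - n) = δ ^ (1 - n) * B ^ (1 - 1 / n) := by
    rw [Real.mul_rpow hδ0.le (by positivity), ← Real.rpow_mul hB]; congr 2; field_simp; ring
  rw [e1, e2, e3, e4] at hε
  have e5 : δ ^ (1 - n) * B ^ (1 - 1 / n) * Λ ≤ δ * B ^ (1 - 1 / n) := by
    calc δ ^ (1 - n) * B ^ (1 - 1 / n) * Λ ≤ δ ^ (1 - n) * B ^ (1 - 1 / n) * δ ^ n := by gcongr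
      _ = (δ ^ (1 - n) * δ ^ n) * B ^ (1 - 1 / n) := by ring
      _ = δ * B ^ (1 - 1 / n) := by rw [← Real.rpow_add hδ0]; simp
  have h3 : B ^ (1 - 1 / n) ≤ 4 * κ * a * B ^ (1 - 1 / R) := by
    have h4 : J ≤ a * (2 * B ^ (1 - 1 / R)) + l * (2 * δ) * B ^ (1 - 1 / n) := by
      have := mul_le_mul_of_nonneg_left e5 hl
      nlinarith
    have h5 := mul_le_mul_of_nonneg_left h4 hκ0
    have h6 := mul_le_mul_of_nonneg_right hδl (by positivity : 0 ≤ B ^ (1 - 1 / n))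
    nlinarith
  have h7 : B ^ (1 / R - 1 / n) ≤ 4 * κ * a := by
    have : B ^ (1 - 1 / n) = B ^ (1 / R - 1 / n) * B ^ (1 - 1 / R) := by
      rw [← Real.rpow_add hB0]; ring_nf
    rw [this] at h3
    exact le_of_mul_le_mul_right h3 (by positivity)
  calc B = (B ^ (1 / R - 1 / n)) ^ (1 / (1 / R - 1 / n)) := by
        rw [← Real.rpow_mul hB, mul_one_div_cancel hgap.ne', Real.rpow_one]
    _ ≤ _ := Real.rpow_le_rpow (by positivity) h7 (by positivity)

/-- Under logarithmic closeness of exponents, powers of numbers in `[0, 1]` are comparable up to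
an error that decays polynomially. -/
lemma rpow_le_const_mul_rpow_add {t α β A ρ m : ℝ} (ht : 0 ≤ t) (ht1 : t ≤ 1) (hα : 1 ≤ α)
    (hρ : Real.exp 1 ≤ ρ) (hm : 0 ≤ m) (h : |α - β| ≤ A / Real.log ρ) :
    t ^ α ≤ Real.exp (m * A) * t ^ β + ρ ^ (-m) := by
  have hρ0 : 0 < ρ := (Real.exp_pos 1).trans_le hρ
  have hlog : 1 ≤ Real.log ρ := by
    rw [Real.le_log_iff_exp_le hρ0]; exact hρ
  rcases le_or_gt t (ρ ^ (-m)) with h1 | h1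
  · calc t ^ α ≤ t ^ (1 : ℝ) := Real.rpow_le_rpow_of_exponent_ge' ht ht1 zero_le_one hα
      _ = t := Real.rpow_one t
      _ ≤ ρ ^ (-m) := h1
      _ ≤ _ := le_add_of_nonneg_left (by positivity)
  · have ht0 : 0 < t := lt_of_le_of_lt (by positivity) h1
    refine le_trans ?_ (le_add_of_nonneg_right (by positivity))
    have hlt : -m * Real.log ρ ≤ Real.log t := by
      rw [← Real.log_rpow hρ0]; exact (Real.log_lt_log (by positivity) h1).le
    have hlt0 : Real.log t ≤ 0 := Real.log_nonpos ht ht1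
    rw [Real.rpow_def_of_pos ht0, Real.rpow_def_of_pos ht0, ← Real.exp_add, Real.exp_le_exp]
    have h2 : |α - β| * Real.log ρ ≤ A := by rwa [le_div_iff₀ (by linarith)] at h
    have h3 : -(α - β) ≤ |α - β| := neg_le_abs _
    have h4 : |α - β| * (-Real.log t) ≤ |α - β| * (m * Real.log ρ) := by
      gcongr; linarith
    nlinarith [mul_le_mul_of_nonneg_left h2 hm,
      mul_le_mul_of_nonneg_right h3 (by linarith : 0 ≤ -Real.log t)]

/-- A Lipschitz function is uniformly approximated from above by smooth functions with the same
Lipschitz constant. -/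
lemma LipschitzWith.exists_contDiff_approx {E : Type*} [NormedAddCommGroup E]
    [InnerProductSpace ℝ E] [FiniteDimensional ℝ E] [MeasurableSpace E] [BorelSpace E]
    {L : NNReal} {s : E → ℝ} (hs : LipschitzWith L s) {ε : ℝ} (hε : 0 < ε) :
    ∃ σ : E → ℝ, ContDiff ℝ 1 σ ∧ LipschitzWith L σ ∧ ∀ x, s x ≤ σ x ∧ σ x ≤ s x + ε := by
  let μ : Measure E := Measure.addHaar
  have hr : 0 < ε / (2 * (L + 1)) := by positivity
  let φ : ContDiffBump (0 : E) := ⟨ε / (2 * (L + 1)) / 2, ε / (2 * (L + 1)), by positivity,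
    half_lt_self hr⟩
  let g : E → ℝ := convolution (φ.normed μ) s (ContinuousLinearMap.lsmul ℝ ℝ) μ
  have hg : ∀ x, g x = ∫ t, φ.normed μ t * s (x - t) ∂μ := fun x => by
    simp [g, convolution_def]
  have hinteg : ∀ x, Integrable (fun t => φ.normed μ t * s (x - t)) μ := fun x =>
    (φ.continuous_normed.mul (hs.continuous.comp (by fun_prop))).integrable_of_hasCompactSupport
      φ.hasCompactSupport_normed.mul_right
  have hclose : ∀ x, |g x - s x| ≤ ε / 2 := fun x => by
    rw [← Real.dist_eq]
    refine φ.dist_normed_convolution_le hs.continuous.aestronglyMeasurable fun y hy => ?_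
    refine (hs.dist_le_mul y x).trans ?_
    have : dist y x ≤ ε / (2 * (L + 1)) := (Metric.mem_ball.1 hy).le
    calc (L : ℝ) * dist y x ≤ (L + 1) * (ε / (2 * (L + 1))) := by gcongr; simp
      _ = ε / 2 := by field_simp
  have hglip : LipschitzWith L g := LipschitzWith.of_dist_le_mul fun x y => by
    rw [Real.dist_eq, hg, hg, ← integral_sub (hinteg x) (hinteg y)]
    calc |∫ t, (φ.normed μ t * s (x - t) - φ.normed μ t * s (y - t)) ∂μ|
        ≤ ∫ t, φ.normed μ t * (L * dist x y) ∂μ := by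
          rw [← Real.norm_eq_abs]
          refine norm_integral_le_of_norm_le ((φ.integrable_normed (μ := μ)).mul_const _)
            (Eventually.of_forall fun t => ?_)
          rw [← mul_sub, Real.norm_eq_abs, abs_mul, abs_of_nonneg (φ.nonneg_normed t)]
          gcongr
          · exact φ.nonneg_normed t
          · simpa [Real.dist_eq] using hs.dist_le_mul (x - t) (y - t)
      _ = L * dist x y := by rw [integral_mul_const, φ.integral_normed, one_mul]
  refine ⟨fun x => g x + ε / 2, ?_, ?_, fun x => ?_⟩
  · exact ContDiff.add (φ.hasCompactSupport_normed.contDiff_convolution_left _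
      φ.contDiff_normed hs.continuous.locallyIntegrable) contDiff_const
  · exact LipschitzWith.of_dist_le_mul fun x y => by simpa using hglip.dist_le_mul x y
  · have := abs_le.1 (hclose x)
    constructor <;> linarith

/-- A smooth nondecreasing approximation of the positive part. -/
noncomputable def smoothPosPart (t : ℝ) : ℝ := t * expNegInvGlue t

lemma smoothPosPart_of_nonpos {t : ℝ} (ht : t ≤ 0) : smoothPosPart t = 0 := by
  simp [smoothPosPart, expNegInvGlue.zero_of_nonpos ht]

lemma smoothPosPart_of_pos {t : ℝ} (ht : 0 < t) :
    smoothPosPart t = t * Real.exp (-t⁻¹) := by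
  simp [smoothPosPart, expNegInvGlue, ht.not_ge]

lemma smoothPosPart_nonneg (t : ℝ) : 0 ≤ smoothPosPart t := by
  rcases le_or_gt t 0 with h | h
  · rw [smoothPosPart_of_nonpos h]
  · rw [smoothPosPart_of_pos h]; positivity

lemma smoothPosPart_le {t : ℝ} (ht : 0 ≤ t) : smoothPosPart t ≤ t := by
  rcases ht.eq_or_lt with h | h
  · rw [← h, smoothPosPart_of_nonpos le_rfl]
  · rw [smoothPosPart_of_pos h]
    exact mul_le_of_le_one_right ht (Real.exp_le_one_iff.2 (by simpa using ht))

lemma sub_one_le_smoothPosPart (t : ℝ) : t - 1 ≤ smoothPosPart t := by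
  rcases le_or_gt t 0 with h | h
  · rw [smoothPosPart_of_nonpos h]; linarith
  · rw [smoothPosPart_of_pos h]
    have := mul_le_mul_of_nonneg_left (Real.add_one_le_exp (-t⁻¹)) h.le
    have e : t * (-t⁻¹ + 1) = t - 1 := by field_simp; ring
    linarith

lemma contDiff_smoothPosPart : ContDiff ℝ 1 smoothPosPart :=
  contDiff_id.mul expNegInvGlue.contDiff

lemma deriv_smoothPosPart_of_nonpos {t : ℝ} (ht : t ≤ 0) : deriv smoothPosPart t = 0 := by
  refine IsLocalMin.deriv_eq_zero (Eventually.of_forall fun y => ?_)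
  rw [smoothPosPart_of_nonpos ht]; exact smoothPosPart_nonneg y

lemma deriv_smoothPosPart_mem (t : ℝ) : deriv smoothPosPart t ∈ Set.Icc (0 : ℝ) 1 := by
  rcases le_or_gt t 0 with h | h
  · simp [deriv_smoothPosPart_of_nonpos h]
  · have h1 : HasDerivAt (fun y : ℝ => y * Real.exp (-y⁻¹))
        (1 * Real.exp (-t⁻¹) + t * (Real.exp (-t⁻¹) * (-(-(t ^ 2)⁻¹)))) t :=
      (hasDerivAt_id t).mul ((hasDerivAt_inv h.ne').neg.exp)
    have h2 : deriv smoothPosPart t = (t⁻¹ + 1) * Real.exp (-t⁻¹) := by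
      have : smoothPosPart =ᶠ[𝓝 t] fun y : ℝ => y * Real.exp (-y⁻¹) := by
        filter_upwards [lt_mem_nhds h] with y hy using smoothPosPart_of_pos hy
      rw [this.deriv_eq, h1.deriv]; field_simp; ring
    rw [h2]
    refine ⟨by positivity, ?_⟩
    rw [Real.exp_neg, ← div_eq_mul_inv, div_le_one (Real.exp_pos _)]
    exact Real.add_one_le_exp _

/-- A `C¹` version of `(|t| - T)₊`. -/
noncomputable def smoothExcess (T t : ℝ) : ℝ := smoothPosPart (t - T) + smoothPosPart (-t - T)

section smoothExcess
variable {T : ℝ}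

lemma contDiff_smoothExcess : ContDiff ℝ 1 (smoothExcess T) :=
  (contDiff_smoothPosPart.comp (by fun_prop)).add (contDiff_smoothPosPart.comp (by fun_prop))

lemma smoothExcess_nonneg (t : ℝ) : 0 ≤ smoothExcess T t :=
  add_nonneg (smoothPosPart_nonneg _) (smoothPosPart_nonneg _)

lemma smoothExcess_of_abs_le {t : ℝ} (h : |t| ≤ T) : smoothExcess T t = 0 := by
  have := abs_le.1 h
  rw [smoothExcess, smoothPosPart_of_nonpos (by linarith), smoothPosPart_of_nonpos (by linarith),
    add_zero]

lemma deriv_smoothExcess (t : ℝ) :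
    deriv (smoothExcess T) t = deriv smoothPosPart (t - T) - deriv smoothPosPart (-t - T) := by
  have hd : Differentiable ℝ smoothPosPart := contDiff_smoothPosPart.differentiable one_ne_zero
  have h1 : HasDerivAt (fun t => smoothPosPart (t - T)) (deriv smoothPosPart (t - T) * 1) t :=
    HasDerivAt.comp (h₂ := smoothPosPart) (h := fun t : ℝ => t - T) t (hd (t - T)).hasDerivAt
      ((hasDerivAt_id' t).sub_const T)
  have h2 : HasDerivAt (fun t => smoothPosPart (-t - T)) (deriv smoothPosPart (-t - T) * (-1)) t :=
    HasDerivAt.comp (h₂ := smoothPosPart) (h := fun t : ℝ => -t - T) t (hd (-t - T)).hasDerivAt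
      ((hasDerivAt_neg t).sub_const T)
  have h3 : HasDerivAt (smoothExcess T)
      (deriv smoothPosPart (t - T) * 1 + deriv smoothPosPart (-t - T) * (-1)) t := h1.add h2
  rw [h3.deriv]
  ring

lemma abs_deriv_smoothExcess_le (t : ℝ) : |deriv (smoothExcess T) t| ≤ 1 := by
  rw [deriv_smoothExcess]
  have h1 := deriv_smoothPosPart_mem (t - T)
  have h2 := deriv_smoothPosPart_mem (-t - T)
  rw [abs_le]; constructor <;> linarith [h1.1, h1.2, h2.1, h2.2]

lemma deriv_smoothExcess_of_abs_le {t : ℝ} (h : |t| ≤ T) : deriv (smoothExcess T) t = 0 := by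
  have := abs_le.1 h
  rw [deriv_smoothExcess, deriv_smoothPosPart_of_nonpos (by linarith),
    deriv_smoothPosPart_of_nonpos (by linarith), sub_zero]

lemma smoothExcess_le_abs (hT : 0 ≤ T) (t : ℝ) : smoothExcess T t ≤ |t| := by
  rcases le_or_gt |t| T with h | h
  · rw [smoothExcess_of_abs_le h]; positivity
  · rcases le_total 0 t with h0 | h0
    · rw [abs_of_nonneg h0] at *
      rw [smoothExcess, smoothPosPart_of_nonpos (by linarith : -t - T ≤ 0)]
      linarith [smoothPosPart_le (by linarith : 0 ≤ t - T)]
    · rw [abs_of_nonpos h0] at *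
      rw [smoothExcess, smoothPosPart_of_nonpos (by linarith : t - T ≤ 0)]
      linarith [smoothPosPart_le (by linarith : 0 ≤ -t - T)]

lemma abs_le_smoothExcess_add (t : ℝ) : |t| ≤ smoothExcess T t + T + 1 := by
  have h1 := sub_one_le_smoothPosPart (t - T)
  have h2 := sub_one_le_smoothPosPart (-t - T)
  have h3 := smoothPosPart_nonneg (t - T)
  have h4 := smoothPosPart_nonneg (-t - T)
  rw [smoothExcess, abs_le]; constructor <;> linarith

variable {E : Type*} [NormedAddCommGroup E] [NormedSpace ℝ E]

lemma norm_fderiv_smoothExcess_comp_le {u : E → ℝ} (hu : ContDiff ℝ 1 u) (x : E) :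
    ‖fderiv ℝ (fun y => smoothExcess T (u y)) x‖ ≤ ‖fderiv ℝ u x‖ ∧
      (|u x| ≤ T → fderiv ℝ (fun y => smoothExcess T (u y)) x = 0) := by
  have h1 : HasFDerivAt (fun y => smoothExcess T (u y))
      (deriv (smoothExcess T) (u x) • fderiv ℝ u x) x :=
    ((contDiff_smoothExcess.differentiable one_ne_zero) (u x)).hasDerivAt.comp_hasFDerivAt x
      ((hu.differentiable one_ne_zero) x).hasFDerivAt
  rw [h1.fderiv]
  refine ⟨?_, fun h => by rw [deriv_smoothExcess_of_abs_le h, zero_smul]⟩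
  rw [norm_smul, Real.norm_eq_abs]
  exact mul_le_of_le_one_left (norm_nonneg _) (abs_deriv_smoothExcess_le _)

lemma HasCompactSupport.smoothExcess_comp {E : Type*} [TopologicalSpace E] (hT : 0 ≤ T)
    {u : E → ℝ} (hu : HasCompactSupport u) :
    HasCompactSupport (fun y => smoothExcess T (u y)) :=
  hu.comp_left (g := smoothExcess T) (smoothExcess_of_abs_le (by simpa using hT))

end smoothExcess

section Sobolev

variable {E : Type*} [NormedAddCommGroup E] [InnerProductSpace ℝ E] [FiniteDimensional ℝ E]
  [MeasurableSpace E] [BorelSpace E] (μ : Measure E) [μ.IsAddHaarMeasure]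

/-- The Gagliardo–Nirenberg–Sobolev inequality at the endpoint, in terms of real functions. -/
lemma exists_sobolev_const {n : ℝ} (hn : (Module.finrank ℝ E : ℝ) = n) (hn1 : 1 < n) :
    ∃ S : ℝ, 0 ≤ S ∧ ∀ (f g : E → ℝ), ContDiff ℝ 1 f → HasCompactSupport f →
      (∀ x, ‖fderiv ℝ f x‖ ≤ g x) →
      ∫⁻ x, ENNReal.ofReal (|f x| ^ (n / (n - 1))) ∂μ ≤
        ENNReal.ofReal S * (∫⁻ x, ENNReal.ofReal (g x) ∂μ) ^ (n / (n - 1)) := by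
  have hconj : Real.HolderConjugate (Module.finrank ℝ E : ℝ) (n / (n - 1)) := by
    rw [hn]; exact Real.HolderConjugate.conjExponent hn1
  have hpos : 0 ≤ n / (n - 1) := div_nonneg (by linarith) (by linarith)
  refine ⟨lintegralPowLePowLIntegralFDerivConst μ (n / (n - 1)), NNReal.coe_nonneg _,
    fun f g hf hcf hg => ?_⟩
  have h := lintegral_pow_le_pow_lintegral_fderiv μ hf hcf hconj
  rw [ENNReal.ofReal_coe_nnreal]
  calc ∫⁻ x, ENNReal.ofReal (|f x| ^ (n / (n - 1))) ∂μ = ∫⁻ x, ‖f x‖ₑ ^ (n / (n - 1)) ∂μ := by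
        congr with x
        rw [← ENNReal.ofReal_rpow_of_nonneg (abs_nonneg _) hpos, ← Real.norm_eq_abs, ofReal_norm]
    _ ≤ _ := h
    _ ≤ _ := by
        gcongr with x
        rw [← ofReal_norm]
        exact ENNReal.ofReal_le_ofReal (hg x)

/-- Sobolev inequality for `(1 + w) ^ s` with a variable Lipschitz exponent `s`. -/
lemma exists_sobolev_const_variable_exponent {n : ℝ} (hn : (Module.finrank ℝ E : ℝ) = n)
    (hn1 : 1 < n) :
    ∃ S : ℝ, 0 ≤ S ∧ ∀ (s w : E → ℝ) (L : NNReal), LipschitzWith L s → (∀ x, 1 ≤ s x) →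
      ContDiff ℝ 1 w → HasCompactSupport w → (∀ x, 0 ≤ w x) →
      ∫⁻ x, ENNReal.ofReal (((1 + w x) ^ s x - 1) ^ (n / (n - 1))) ∂μ ≤
        ENNReal.ofReal S * (∫⁻ x, ENNReal.ofReal (2 * s x * ((1 + w x) ^ (s x - 1) *
          ‖fderiv ℝ w x‖) + 2 * L * ((1 + w x) ^ s x * Real.log (1 + w x))) ∂μ)
            ^ (n / (n - 1)) := by
  obtain ⟨S, hS, hsob⟩ := exists_sobolev_const μ hn hn1
  refine ⟨S, hS, fun s w L hs hs1 hw hcw hw0 => ?_⟩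
  obtain ⟨W, hW⟩ : ∃ W, ∀ x, w x ≤ W := by
    obtain ⟨W, hW⟩ := hcw.exists_bound_of_continuous hw.continuous
    exact ⟨W, fun x => (le_abs_self _).trans (hW x)⟩
  have hW0 : 0 ≤ W := (hw0 0).trans (hW 0)
  obtain ⟨ε, hε, hε2⟩ : ∃ ε : ℝ, 0 < ε ∧ (1 + ε) * (1 + W) ^ ε ≤ 2 := by
    have hcont : Continuous fun ε : ℝ => (1 + ε) * (1 + W) ^ ε :=
      (continuous_const.add continuous_id).mul
        (Real.continuous_const_rpow (by linarith))
    have h0 : Tendsto (fun ε : ℝ => (1 + ε) * (1 + W) ^ ε) (𝓝[>] 0) (𝓝 1) := by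
      have := hcont.tendsto 0
      simp only [add_zero, Real.rpow_zero, mul_one] at this
      exact this.mono_left nhdsWithin_le_nhds
    obtain ⟨ε, h1, h2⟩ := ((h0.eventually (gt_mem_nhds (by norm_num : (1 : ℝ) < 2))).and
      self_mem_nhdsWithin).exists
    exact ⟨ε, h2, h1.le⟩
  obtain ⟨σ, hσ, hσL, hσs⟩ := hs.exists_contDiff_approx hε
  have h1w : ∀ x, 1 ≤ 1 + w x := fun x => by linarith [hw0 x]
  have h1w0 : ∀ x, 0 < 1 + w x := fun x => by linarith [hw0 x]
  have hlow : ∀ x, (1 + w x) ^ s x - 1 ≤ |(1 + w x) ^ σ x - 1| := fun x =>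
    (sub_le_sub_right (Real.rpow_le_rpow_of_exponent_le (h1w x) (hσs x).1) 1).trans
      (le_abs_self _)
  have hnn : ∀ x, 0 ≤ (1 + w x) ^ s x - 1 := fun x =>
    sub_nonneg.2 (Real.one_le_rpow (h1w x) (by linarith [hs1 x]))
  refine le_trans (lintegral_mono fun x => ENNReal.ofReal_le_ofReal
    (Real.rpow_le_rpow (hnn x) (hlow x) (div_nonneg (by linarith) (by linarith)))) ?_
  refine hsob (fun x => (1 + w x) ^ σ x - 1) _ ?_ ?_ fun x => ?_
  · exact ((contDiff_const.add hw).rpow hσ fun x => (h1w0 x).ne').sub contDiff_const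
  · refine hcw.mono fun x hx => ?_
    contrapose! hx
    simp only [Function.mem_support, not_not] at hx ⊢
    simp [hx]
  · have hwd : HasFDerivAt (fun x => 1 + w x) (fderiv ℝ w x) x :=
      ((hw.differentiable one_ne_zero) x).hasFDerivAt.const_add 1
    have hσd : HasFDerivAt σ (fderiv ℝ σ x) x :=
      ((hσ.differentiable one_ne_zero) x).hasFDerivAt
    rw [((hwd.rpow hσd (h1w0 x)).sub_const 1).fderiv]
    have hlog : 0 ≤ Real.log (1 + w x) := Real.log_nonneg (h1w x)
    have hs0 : 0 ≤ s x := by linarith [hs1 x]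
    have hσ0 : 0 ≤ σ x := hs0.trans (hσs x).1
    have hWε : (1 + w x) ^ ε ≤ (1 + W) ^ ε :=
      Real.rpow_le_rpow (h1w0 x).le (by linarith [hW x]) hε.le
    have hWε0 : 0 ≤ (1 + w x) ^ ε := (Real.rpow_pos_of_pos (h1w0 x) ε).le
    have hq0 : 0 ≤ (1 + w x) ^ s x := (Real.rpow_pos_of_pos (h1w0 x) _).le
    have hq1 : 0 ≤ (1 + w x) ^ (s x - 1) := (Real.rpow_pos_of_pos (h1w0 x) _).le
    have hpow : (1 + w x) ^ σ x ≤ 2 * (1 + w x) ^ s x := by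
      calc (1 + w x) ^ σ x ≤ (1 + w x) ^ (ε + s x) :=
            Real.rpow_le_rpow_of_exponent_le (h1w x) (by linarith [(hσs x).2])
        _ = (1 + w x) ^ ε * (1 + w x) ^ s x := Real.rpow_add (h1w0 x) _ _
        _ ≤ 2 * (1 + w x) ^ s x := by
            gcongr
            nlinarith
    have hpow' : σ x * (1 + w x) ^ (σ x - 1) ≤ 2 * s x * (1 + w x) ^ (s x - 1) := by
      calc σ x * (1 + w x) ^ (σ x - 1)
          ≤ (s x * (1 + ε)) * (1 + w x) ^ (ε + (s x - 1)) := by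
            gcongr
            · exact (Real.rpow_pos_of_pos (h1w0 x) _).le
            · nlinarith [(hσs x).2, hs1 x]
            · exact h1w x
            · linarith [(hσs x).2]
        _ = ((1 + ε) * (1 + w x) ^ ε) * (s x * (1 + w x) ^ (s x - 1)) := by
            rw [Real.rpow_add (h1w0 x)]; ring
        _ ≤ 2 * (s x * (1 + w x) ^ (s x - 1)) := by
            gcongr
            nlinarith
        _ = _ := by ring
    refine (norm_add_le _ _).trans (add_le_add ?_ ?_)
    · rw [norm_smul, Real.norm_eq_abs, abs_of_nonneg (mul_nonneg hσ0
        (Real.rpow_pos_of_pos (h1w0 x) _).le), ← mul_assoc]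
      gcongr
    · rw [norm_smul, Real.norm_eq_abs, abs_of_nonneg (mul_nonneg
        (Real.rpow_pos_of_pos (h1w0 x) _).le hlog)]
      calc (1 + w x) ^ σ x * Real.log (1 + w x) * ‖fderiv ℝ σ x‖
          ≤ 2 * (1 + w x) ^ s x * Real.log (1 + w x) * L := by
            gcongr
            exact norm_fderiv_le_of_lipschitz ℝ hσL
        _ = _ := by ring

end Sobolev

lemma lintegral_ofReal_le_of_le_combination {α : Type*} [MeasurableSpace α] {ν : Measure α}
    {g f₁ f₂ f₃ : α → ℝ} {c₁ c₂ c₃ I₁ I₂ I₃ : ℝ} (hc₁ : 0 ≤ c₁) (hc₂ : 0 ≤ c₂) (hc₃ : 0 ≤ c₃)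
    (hI₁ : 0 ≤ I₁) (hI₂ : 0 ≤ I₂) (hI₃ : 0 ≤ I₃) (hf₁ : AEMeasurable f₁ ν)
    (hf₂ : AEMeasurable f₂ ν) (hg : ∀ᵐ x ∂ν, g x ≤ c₁ * f₁ x + c₂ * f₂ x + c₃ * f₃ x)
    (h₁ : ∫⁻ x, ENNReal.ofReal (f₁ x) ∂ν ≤ ENNReal.ofReal I₁)
    (h₂ : ∫⁻ x, ENNReal.ofReal (f₂ x) ∂ν ≤ ENNReal.ofReal I₂)
    (h₃ : ∫⁻ x, ENNReal.ofReal (f₃ x) ∂ν ≤ ENNReal.ofReal I₃) :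
    ∫⁻ x, ENNReal.ofReal (g x) ∂ν ≤ ENNReal.ofReal (c₁ * I₁ + c₂ * I₂ + c₃ * I₃) := by
  calc ∫⁻ x, ENNReal.ofReal (g x) ∂ν
      ≤ ∫⁻ x, (ENNReal.ofReal c₁ * ENNReal.ofReal (f₁ x) + ENNReal.ofReal c₂ *
          ENNReal.ofReal (f₂ x) + ENNReal.ofReal c₃ * ENNReal.ofReal (f₃ x)) ∂ν := by
        refine lintegral_mono_ae (hg.mono fun x hx => (ENNReal.ofReal_le_ofReal hx).trans ?_)
        rw [← ENNReal.ofReal_mul hc₁, ← ENNReal.ofReal_mul hc₂, ← ENNReal.ofReal_mul hc₃]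
        exact ENNReal.ofReal_add_le.trans (by gcongr; exact ENNReal.ofReal_add_le)
    _ = ENNReal.ofReal c₁ * ∫⁻ x, ENNReal.ofReal (f₁ x) ∂ν + ENNReal.ofReal c₂ *
          ∫⁻ x, ENNReal.ofReal (f₂ x) ∂ν + ENNReal.ofReal c₃ * ∫⁻ x, ENNReal.ofReal (f₃ x) ∂ν := by
        have hm : AEMeasurable (fun x => ENNReal.ofReal c₁ * ENNReal.ofReal (f₁ x) +
            ENNReal.ofReal c₂ * ENNReal.ofReal (f₂ x)) ν :=
          (hf₁.ennreal_ofReal.const_mul _).add (hf₂.ennreal_ofReal.const_mul _)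
        rw [lintegral_add_left' hm, lintegral_add_left' (hf₁.ennreal_ofReal.const_mul _),
          lintegral_const_mul' _ _ ENNReal.ofReal_ne_top,
          lintegral_const_mul' _ _ ENNReal.ofReal_ne_top,
          lintegral_const_mul' _ _ ENNReal.ofReal_ne_top]
    _ ≤ ENNReal.ofReal c₁ * ENNReal.ofReal I₁ + ENNReal.ofReal c₂ * ENNReal.ofReal I₂ +
          ENNReal.ofReal c₃ * ENNReal.ofReal I₃ := by gcongr
    _ = _ := by
        rw [← ENNReal.ofReal_mul hc₁, ← ENNReal.ofReal_mul hc₂, ← ENNReal.ofReal_mul hc₃,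
          ← ENNReal.ofReal_add (by positivity) (by positivity),
          ← ENNReal.ofReal_add (by positivity) (by positivity)]

lemma sobolev_conj_exponent {n p : ℝ} (hp : 1 < p) (hpn : p < n) :
    1 < n * p / (n - p) * (1 - 1 / n) ∧
      n * p / (n - p) * (1 - 1 / n) - 1 = n * p / (n - p) * (1 - 1 / p) := by
  have h1 : 0 < n - p := by linarith
  have h2 : 0 < n := by linarith
  have h3 : 0 < p := by linarith
  constructor
  · have : n * p / (n - p) * (1 - 1 / n) = p * (n - 1) / (n - p) := by field_simp
    rw [this, lt_div_iff₀ h1]; nlinarith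
  · field_simp; ring

lemma sobolev_exponent_mono {n p r : ℝ} (hp : 0 < p) (hpr : p ≤ r) (hrn : r < n) :
    n * p / (n - p) ≤ n * r / (n - r) := by
  have : 0 < n := by linarith
  exact div_le_div₀ (by nlinarith) (by nlinarith) (by linarith) (by linarith)

lemma abs_sobolev_exponent_sub_le {n p r R : ℝ} (hn : 0 < n) (hp : p ≤ R) (hr : r ≤ R)
    (hRn : R < n) :
    |n * p / (n - p) - n * r / (n - r)| ≤ n ^ 2 / (n - R) ^ 2 * |p - r| := by
  have h1 : 0 < n - p := by linarith
  have h2 : 0 < n - r := by linarith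
  have h3 : 0 < n - R := by linarith
  have : n * p / (n - p) - n * r / (n - r) = n ^ 2 / ((n - p) * (n - r)) * (p - r) := by
    field_simp; ring
  rw [this, abs_mul, abs_of_nonneg (by positivity)]
  gcongr
  nlinarith

lemma rpow_le_two_rpow_mul_sub_one_rpow_add {y r : ℝ} (hy : 1 ≤ y) (hr : 0 ≤ r) :
    y ^ r ≤ 2 ^ r * (y - 1) ^ r + 2 ^ r := by
  have h0 : 0 ≤ (y - 1) ^ r := Real.rpow_nonneg (by linarith) _
  rcases le_or_gt y 2 with h | h
  · have : y ^ r ≤ 2 ^ r := Real.rpow_le_rpow (by linarith) h hr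
    have : 0 ≤ (2 : ℝ) ^ r * (y - 1) ^ r := by positivity
    linarith
  · have : y ^ r ≤ (2 * (y - 1)) ^ r := Real.rpow_le_rpow (by linarith) (by linarith) hr
    rw [Real.mul_rpow (by norm_num) (by linarith)] at this
    have : (0 : ℝ) ≤ 2 ^ r := by positivity
    linarith

lemma log_rpow_le {n y : ℝ} (hn : 0 < n) (hy : 1 ≤ y) : Real.log y ^ n ≤ n ^ n * y := by
  have h1 : Real.log y ≤ n * y ^ (1 / n) := by
    have := Real.log_le_rpow_div (by linarith : 0 ≤ y) (by positivity : 0 < 1 / n)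
    rw [div_div_eq_mul_div, div_one, mul_comm] at this
    exact this
  calc Real.log y ^ n ≤ (n * y ^ (1 / n)) ^ n :=
        Real.rpow_le_rpow (Real.log_nonneg hy) h1 hn.le
    _ = n ^ n * y := by
        rw [Real.mul_rpow hn.le (by positivity), ← Real.rpow_mul (by linarith),
          one_div_mul_cancel hn.ne', Real.rpow_one]

/-- A priori bound for the critical modular on the set where `u` is large. -/
lemma exists_lintegral_large_le {E : Type*} [NormedAddCommGroup E] [InnerProductSpace ℝ E]
    [FiniteDimensional ℝ E] [MeasurableSpace E] [BorelSpace E] (μ : Measure E)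
    [μ.IsAddHaarMeasure] {n R γ D : ℝ} (hn : (Module.finrank ℝ E : ℝ) = n) {K : NNReal}
    {p : E → ℝ} (hp : LipschitzWith K p) (hp1 : ∀ x, 1 < p x) (hpR : ∀ x, p x ≤ R)
    (hRn : R < n) (hγ : 1 < γ) (hD : 0 ≤ D) :
    ∃ C : ℝ, 0 ≤ C ∧ ∀ u : E → ℝ, ContDiff ℝ 1 u → HasCompactSupport u →
      ∫⁻ x, ENNReal.ofReal (‖fderiv ℝ u x‖ ^ p x) ∂μ ≤ 1 →
      ∫⁻ x in {x | 1 < |u x|}, ENNReal.ofReal (|u x| ^ γ) ∂μ ≤ ENNReal.ofReal D →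
      ∫⁻ x in {x | 1 < |u x|}, ENNReal.ofReal (|u x| ^ (n * p x / (n - p x))) ∂μ ≤
        ENNReal.ofReal C := by
  have hR1 : 1 < R := (hp1 0).trans_le (hpR 0)
  have hn1 : 1 < n := by linarith
  have hn0 : 0 < n := by linarith
  have hnR : 0 < n - R := by linarith
  have hn' : 0 ≤ n / (n - 1) := div_nonneg hn0.le (by linarith)
  obtain ⟨S, hS, hsob⟩ := exists_sobolev_const_variable_exponent μ hn hn1
  set P : E → ℝ := fun x => n * p x / (n - p x) with hP
  set s : E → ℝ := fun x => P x * (1 - 1 / n) with hs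
  set Pm : ℝ := n * R / (n - R) with hPm
  have hPm0 : 0 < Pm := by positivity
  have hnn : 0 ≤ 1 - 1 / n := by rw [sub_nonneg, div_le_one hn0]; exact hn1.le
  have hnn1 : 1 - 1 / n ≤ 1 := by
    have : 0 < 1 / n := by positivity
    linarith
  have hPPm : ∀ x, P x ≤ Pm := fun x =>
    sobolev_exponent_mono (by linarith [hp1 x]) (hpR x) hRn
  have hs1 : ∀ x, 1 ≤ s x := fun x => (sobolev_conj_exponent (hp1 x) ((hpR x).trans_lt hRn)).1.le
  have hP0 : ∀ x, 0 ≤ P x := fun x => by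
    have := hp1 x
    exact div_nonneg (by nlinarith) (by linarith [hpR x])
  have hsPm : ∀ x, s x ≤ Pm := fun x =>
    (mul_le_of_le_one_right (hP0 x) hnn1).trans (hPPm x)
  have hPc : Continuous P := by
    have := hp.continuous
    exact (continuous_const.mul this).div (continuous_const.sub this)
      fun x => by linarith [hpR x]
  obtain ⟨L, hL⟩ : ∃ L : NNReal, (L : ℝ) = n ^ 2 / (n - R) ^ 2 * K :=
    ⟨Real.toNNReal (n ^ 2 / (n - R) ^ 2 * K), Real.coe_toNNReal _ (by positivity)⟩
  have hsL : LipschitzWith L s := LipschitzWith.of_dist_le_mul fun x y => by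
    have h1 := abs_sobolev_exponent_sub_le hn0 (hpR x) (hpR y) hRn
    have h2 := hp.dist_le_mul x y
    rw [Real.dist_eq] at h2 ⊢
    calc |s x - s y| = |P x - P y| * (1 - 1 / n) := by
          rw [hs, ← sub_mul, abs_mul, abs_of_nonneg hnn]
      _ ≤ |P x - P y| := mul_le_of_le_one_right (abs_nonneg _) hnn1
      _ ≤ n ^ 2 / (n - R) ^ 2 * |p x - p y| := h1
      _ ≤ n ^ 2 / (n - R) ^ 2 * (K * dist x y) := by gcongr
      _ = L * dist x y := by rw [hL]; ring
  obtain ⟨δ, C₀, hδ, hC₀, habs⟩ := exists_bound_of_absorb (n := n) (R := R)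
    (c := 2 ^ (n / (n - 1)) * S) (D := 2 ^ (n / (n - 1)) * D) (a := 2 * Pm) (l := 2 * L)
    hR1 hRn (by positivity) (by positivity) (by positivity)
  obtain ⟨T, hT1, hTδ⟩ : ∃ T : ℝ, 1 ≤ T ∧ n ^ n * 2 * T ^ (1 - γ) * D ≤ δ ^ n := by
    have h0 : Tendsto (fun T : ℝ => n ^ n * 2 * T ^ (1 - γ) * D) atTop (𝓝 0) := by
      have := ((tendsto_rpow_neg_atTop (by linarith : 0 < γ - 1)).const_mul
        (n ^ n * 2)).mul_const D
      simpa [neg_sub] using this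
    obtain ⟨T, h1, h2⟩ := ((h0.eventually (gt_mem_nhds (by positivity : 0 < δ ^ n))).and
      (eventually_ge_atTop 1)).exists
    exact ⟨T, h2, h1.le⟩
  refine ⟨(T + 1) ^ Pm * C₀, by positivity, fun u hu hcu hgrad hlarge => ?_⟩
  set G : Set E := {x | 1 < |u x|} with hG
  have hGm : MeasurableSet G := measurableSet_lt measurable_const hu.continuous.abs.measurable
  set w : E → ℝ := fun x => smoothExcess T (u x) with hw
  have hwC : ContDiff ℝ 1 w := contDiff_smoothExcess.comp hu
  have hcw : HasCompactSupport w := hcu.smoothExcess_comp (by linarith)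
  have hw0 : ∀ x, 0 ≤ w x := fun x => smoothExcess_nonneg _
  have h1w : ∀ x, 1 ≤ 1 + w x := fun x => by linarith [hw0 x]
  have h1w0 : ∀ x, 0 < 1 + w x := fun x => by linarith [hw0 x]
  have hXc : Continuous fun x => (1 + w x) ^ P x :=
    (continuous_const.add hwC.continuous).rpow hPc fun x => Or.inl (h1w0 x).ne'
  obtain ⟨W, hW⟩ : ∃ W, ∀ x, w x ≤ W := by
    obtain ⟨W, hW⟩ := hcw.exists_bound_of_continuous hwC.continuous
    exact ⟨W, fun x => (le_abs_self _).trans (hW x)⟩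
  have hW0 : 0 ≤ W := (hw0 0).trans (hW 0)
  have hμG : ∫⁻ _ in G, ENNReal.ofReal 1 ∂μ ≤ ENNReal.ofReal D := by
    refine le_trans (setLIntegral_mono' hGm fun x hx => ENNReal.ofReal_le_ofReal ?_) hlarge
    exact Real.one_le_rpow (le_of_lt hx) (by linarith)
  set B : ENNReal := ∫⁻ x in G, ENNReal.ofReal ((1 + w x) ^ P x) ∂μ with hB
  have hBtop : B ≠ ⊤ := by
    have : B ≤ ENNReal.ofReal ((1 + W) ^ Pm * D + 0 * 0 + 0 * 0) := by
      refine lintegral_ofReal_le_of_le_combination (f₁ := fun _ => 1) (f₂ := fun _ => 0)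
        (f₃ := fun _ => 0) (by positivity) le_rfl le_rfl hD le_rfl le_rfl (by fun_prop)
        (by fun_prop) (Eventually.of_forall fun x => ?_) hμG (by simp) (by simp)
      have h1 : (1 + w x) ^ P x ≤ (1 + w x) ^ Pm :=
        Real.rpow_le_rpow_of_exponent_le (h1w x) (hPPm x)
      have h2 : (1 + w x) ^ Pm ≤ (1 + W) ^ Pm :=
        Real.rpow_le_rpow (h1w0 x).le (by linarith [hW x]) hPm0.le
      linarith
    exact ne_top_of_le_ne_top ENNReal.ofReal_ne_top this
  set g : E → ℝ := fun x => 2 * s x * ((1 + w x) ^ (s x - 1) * ‖fderiv ℝ w x‖) +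
    2 * L * ((1 + w x) ^ s x * Real.log (1 + w x)) with hg
  set J : ENNReal := ∫⁻ x, ENNReal.ofReal (g x) ∂μ with hJ
  have hgoff : ∀ x, x ∉ G → g x = 0 := fun x hx => by
    have h1 : |u x| ≤ T := (not_lt.1 hx).trans hT1
    have h2 : w x = 0 := smoothExcess_of_abs_le h1
    have h3 : fderiv ℝ w x = 0 := (norm_fderiv_smoothExcess_comp_le hu x).2 h1
    simp [hg, h2, h3]
  have hJG : J = ∫⁻ x in G, ENNReal.ofReal (g x) ∂μ := by
    rw [hJ, ← lintegral_indicator hGm]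
    congr with x
    by_cases hx : x ∈ G
    · rw [Set.indicator_of_mem hx]
    · rw [Set.indicator_of_notMem hx, hgoff x hx, ENNReal.ofReal_zero]
  have hlogw : ∀ x, Real.log (1 + w x) ^ n ≤ n ^ n * 2 * T ^ (1 - γ) * |u x| ^ γ := fun x => by
    rcases le_or_gt |u x| T with h | h
    · have : w x = 0 := smoothExcess_of_abs_le h
      rw [this, add_zero, Real.log_one, Real.zero_rpow hn0.ne']
      positivity
    · have hu1 : 0 < |u x| := by linarith
      calc Real.log (1 + w x) ^ n ≤ n ^ n * (1 + w x) := log_rpow_le hn0 (h1w x)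
        _ ≤ n ^ n * (2 * |u x|) := by
            gcongr
            have : w x ≤ |u x| := smoothExcess_le_abs (by linarith) _
            linarith
        _ = n ^ n * 2 * |u x| ^ (1 - γ) * |u x| ^ γ := by
            rw [mul_assoc _ _ (|u x| ^ γ), ← Real.rpow_add hu1]; simp; ring
        _ ≤ _ := by
            have : |u x| ^ (1 - γ) ≤ T ^ (1 - γ) :=
              Real.rpow_le_rpow_of_nonpos (by linarith) h.le (by linarith)
            gcongr
  have hJle : ∀ ε η : ℝ, 0 < ε → ε ≤ 1 → 0 < η →
      J ≤ ENNReal.ofReal (2 * Pm * (ε * B.toReal + ε ^ (1 - R)) +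
        2 * L * (η * B.toReal + η ^ (1 - n) * (n ^ n * 2 * T ^ (1 - γ) * D))) := by
    intro ε η hε hε1 hη
    rw [hJG]
    have key := lintegral_ofReal_le_of_le_combination (ν := μ.restrict G) (g := g)
      (f₁ := fun x => (1 + w x) ^ P x) (f₂ := fun x => |u x| ^ γ)
      (f₃ := fun x => ‖fderiv ℝ u x‖ ^ p x) (c₁ := 2 * Pm * ε + 2 * L * η)
      (c₂ := 2 * L * η ^ (1 - n) * (n ^ n * 2 * T ^ (1 - γ)))
      (c₃ := 2 * Pm * ε ^ (1 - R)) (I₁ := B.toReal) (I₂ := D) (I₃ := 1)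
      (by positivity) (by positivity) (by positivity) (by positivity) hD zero_le_one
      hXc.measurable.aemeasurable
      ((hu.continuous.abs.rpow_const fun x => Or.inr (by linarith)).measurable.aemeasurable)
      (Eventually.of_forall fun x => ?_) (ENNReal.ofReal_toReal hBtop).ge hlarge
      ((lintegral_mono' Measure.restrict_le_self le_rfl).trans
        (by simpa using hgrad))
    · refine key.trans (ENNReal.ofReal_le_ofReal (le_of_eq ?_))
      ring
    · have hX0 : 0 ≤ (1 + w x) ^ P x := (Real.rpow_pos_of_pos (h1w0 x) _).le
      have hlog0 : 0 ≤ Real.log (1 + w x) := Real.log_nonneg (h1w x)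
      have y1 : (1 + w x) ^ (s x - 1) * ‖fderiv ℝ w x‖ ≤
          ε * (1 + w x) ^ P x + ε ^ (1 - R) * ‖fderiv ℝ u x‖ ^ p x := by
        have h1 := rpow_mul_le_add_of_pos hX0 (norm_nonneg (fderiv ℝ w x)) (hp1 x) hε
        rw [← Real.rpow_mul (h1w0 x).le,
          ← (sobolev_conj_exponent (hp1 x) ((hpR x).trans_lt hRn)).2] at h1
        refine h1.trans ?_
        have h2 : ε ^ (1 - p x) ≤ ε ^ (1 - R) :=
          Real.rpow_le_rpow_of_exponent_ge hε hε1 (by linarith [hpR x])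
        have h3 : ‖fderiv ℝ w x‖ ^ p x ≤ ‖fderiv ℝ u x‖ ^ p x :=
          Real.rpow_le_rpow (norm_nonneg _) (norm_fderiv_smoothExcess_comp_le hu x).1
            (by linarith [hp1 x])
        gcongr
      have y2 : (1 + w x) ^ s x * Real.log (1 + w x) ≤
          η * (1 + w x) ^ P x + η ^ (1 - n) * (n ^ n * 2 * T ^ (1 - γ) * |u x| ^ γ) := by
        have h1 := rpow_mul_le_add_of_pos hX0 hlog0 hn1 hη
        rw [← Real.rpow_mul (h1w0 x).le] at h1
        refine h1.trans ?_
        gcongr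
        exact hlogw x
      have z1 : 2 * s x * ((1 + w x) ^ (s x - 1) * ‖fderiv ℝ w x‖) ≤
          2 * Pm * (ε * (1 + w x) ^ P x + ε ^ (1 - R) * ‖fderiv ℝ u x‖ ^ p x) := by
        have h0 := hs1 x
        have h1 := hsPm x
        have h2 : 0 ≤ (1 + w x) ^ (s x - 1) := (Real.rpow_pos_of_pos (h1w0 x) _).le
        gcongr
      have z2 := mul_le_mul_of_nonneg_left y2 (by positivity : 0 ≤ 2 * (L : ℝ))
      calc g x ≤ _ := add_le_add z1 z2
        _ = _ := by ring
  have hJtop : J ≠ ⊤ := ne_top_of_le_ne_top ENNReal.ofReal_ne_top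
    (hJle 1 1 one_pos le_rfl one_pos)
  have hBJ : B ≤ ENNReal.ofReal (2 ^ (n / (n - 1)) * (S * J.toReal ^ (n / (n - 1))) +
      2 ^ (n / (n - 1)) * D + 0 * 0) := by
    have h1 : ∫⁻ x in G, ENNReal.ofReal (((1 + w x) ^ s x - 1) ^ (n / (n - 1))) ∂μ ≤
        ENNReal.ofReal (S * J.toReal ^ (n / (n - 1))) := by
      refine (lintegral_mono' Measure.restrict_le_self le_rfl).trans
        ((hsob s w L hsL hs1 hwC hcw hw0).trans (le_of_eq ?_))
      rw [ENNReal.ofReal_mul hS, ← ENNReal.ofReal_rpow_of_nonneg ENNReal.toReal_nonneg hn',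
        ENNReal.ofReal_toReal hJtop]
    have hsc : Continuous s := hPc.mul continuous_const
    have hfm : Measurable fun x => ((1 + w x) ^ s x - 1) ^ (n / (n - 1)) :=
      ((((continuous_const.add hwC.continuous).rpow hsc fun x => Or.inl (h1w0 x).ne').sub
        continuous_const).rpow_const fun x => Or.inr hn').measurable
    refine lintegral_ofReal_le_of_le_combination (f₂ := fun _ => 1) (f₃ := fun _ => 0)
      (by positivity) (by positivity) le_rfl (by positivity) hD le_rfl hfm.aemeasurable
      (by fun_prop) (Eventually.of_forall fun x => ?_) h1 hμG (by simp)
    have h2 := rpow_le_two_rpow_mul_sub_one_rpow_add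
      (Real.one_le_rpow (h1w x) (by linarith [hs1 x]) : 1 ≤ (1 + w x) ^ s x) hn'
    rw [← Real.rpow_mul (h1w0 x).le] at h2
    have h3 : s x * (n / (n - 1)) = P x := by
      have : n - 1 ≠ 0 := by linarith
      simp only [hs]; field_simp
    rw [h3] at h2
    linarith
  have hBC : B.toReal ≤ C₀ := by
    refine habs B.toReal J.toReal _ ENNReal.toReal_nonneg ENNReal.toReal_nonneg hTδ ?_ ?_
    · have := ENNReal.toReal_le_of_le_ofReal (by positivity) hBJ
      linarith
    · intro ε η hε hε1 hη
      exact ENNReal.toReal_le_of_le_ofReal (by positivity) (hJle ε η hε hε1 hη)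
  have hfin := lintegral_ofReal_le_of_le_combination (ν := μ.restrict G)
    (g := fun x => |u x| ^ P x) (f₁ := fun x => (1 + w x) ^ P x) (f₂ := fun _ => 0)
    (f₃ := fun _ => 0) (c₁ := (T + 1) ^ Pm) (c₂ := 0) (c₃ := 0) (I₁ := C₀) (I₂ := 0) (I₃ := 0)
    (by positivity) le_rfl le_rfl hC₀ le_rfl le_rfl hXc.measurable.aemeasurable
    (by fun_prop) (Eventually.of_forall fun x => ?_)
    ((ENNReal.le_ofReal_iff_toReal_le hBtop hC₀).2 hBC) (by simp) (by simp)
  · simpa using hfin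
  · have h1 : |u x| ≤ (T + 1) * (1 + w x) := by
      have : |u x| ≤ w x + T + 1 := abs_le_smoothExcess_add _
      nlinarith [hw0 x]
    calc |u x| ^ P x ≤ ((T + 1) * (1 + w x)) ^ P x :=
          Real.rpow_le_rpow (abs_nonneg _) h1 (hP0 x)
      _ = (T + 1) ^ P x * (1 + w x) ^ P x := Real.mul_rpow (by linarith) (h1w0 x).le
      _ ≤ (T + 1) ^ Pm * (1 + w x) ^ P x := by
          gcongr
          · exact (Real.rpow_pos_of_pos (h1w0 x) _).le
          · linarith
          · exact hPPm x
      _ = _ := by ring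

/-- A smooth bounded truncation of the identity. -/
noncomputable def smoothTrunc (t : ℝ) : ℝ := t / √(1 + t ^ 2)

lemma contDiff_smoothTrunc : ContDiff ℝ 1 smoothTrunc := by
  refine contDiff_id.div ((contDiff_const.add (contDiff_id.pow 2)).sqrt fun t => ?_) fun t => ?_
  · simp only [id]; positivity
  · positivity

lemma abs_smoothTrunc (t : ℝ) : |smoothTrunc t| = |t| / √(1 + t ^ 2) := by
  rw [smoothTrunc, abs_div, abs_of_pos (by positivity : 0 < √(1 + t ^ 2))]

lemma abs_smoothTrunc_le_one (t : ℝ) : |smoothTrunc t| ≤ 1 := by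
  rw [abs_smoothTrunc, div_le_one (by positivity)]
  exact Real.abs_le_sqrt (by linarith)

lemma one_le_two_mul_abs_smoothTrunc {t : ℝ} (ht : 1 ≤ |t|) : 1 ≤ 2 * |smoothTrunc t| := by
  rw [abs_smoothTrunc, mul_div_assoc', le_div_iff₀ (by positivity), one_mul,
    Real.sqrt_le_left (by positivity), mul_pow, sq_abs]
  nlinarith [sq_abs t]

lemma abs_le_two_mul_abs_smoothTrunc {t : ℝ} (ht : |t| ≤ 1) : |t| ≤ 2 * |smoothTrunc t| := by
  rw [abs_smoothTrunc, mul_div_assoc', le_div_iff₀ (by positivity), mul_comm]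
  gcongr
  rw [Real.sqrt_le_left (by norm_num)]
  nlinarith [sq_abs t, abs_nonneg t]

lemma abs_deriv_smoothTrunc_le (t : ℝ) : |deriv smoothTrunc t| ≤ 1 := by
  have h0 : 0 < 1 + t ^ 2 := by positivity
  have hs : 0 < √(1 + t ^ 2) := by positivity
  have h1 : HasDerivAt (fun y : ℝ => 1 + y ^ 2) (2 * t) t := by
    simpa using (hasDerivAt_pow 2 t).const_add 1
  have h2 : HasDerivAt smoothTrunc
      ((1 * √(1 + t ^ 2) - t * (2 * t / (2 * √(1 + t ^ 2)))) / √(1 + t ^ 2) ^ 2) t :=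
    (hasDerivAt_id' t).div (h1.sqrt h0.ne') hs.ne'
  have h3 : deriv smoothTrunc t = 1 / ((1 + t ^ 2) * √(1 + t ^ 2)) := by
    rw [h2.deriv]
    field_simp
    rw [Real.sq_sqrt h0.le]
    ring
  rw [h3, abs_of_pos (by positivity), div_le_one (by positivity)]
  have : 1 ≤ √(1 + t ^ 2) := Real.one_le_sqrt.2 (by nlinarith)
  nlinarith

section

variable {E : Type*} [NormedAddCommGroup E] [InnerProductSpace ℝ E]
    [FiniteDimensional ℝ E] [MeasurableSpace E] [BorelSpace E] (μ : Measure E)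
    [μ.IsAddHaarMeasure] {n R : ℝ}

/-- A priori bounds for the critical modular where `u` is small and for the measure of the set where
`u` is large, for exponents satisfying the logarithmic decay condition. -/
lemma exists_lintegral_small_le (hn : (Module.finrank ℝ E : ℝ) = n)
    {p : E → ℝ} (hp : Continuous p) (hp1 : ∀ x, 1 < p x) (hpR : ∀ x, p x ≤ R)
    (hRn : R < n) {pinf C₀ : ℝ} (hpinf1 : 1 < pinf) (hpinfR : pinf ≤ R)
    (hdecay : ∀ x, |p x - pinf| ≤ C₀ / Real.log (Real.exp 1 + ‖x‖)) :
    ∃ C : ℝ, 0 ≤ C ∧ ∀ u : E → ℝ, ContDiff ℝ 1 u → HasCompactSupport u →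
      ∫⁻ x, ENNReal.ofReal (‖fderiv ℝ u x‖ ^ p x) ∂μ ≤ 1 →
      ∫⁻ _ in {x | 1 < |u x|}, ENNReal.ofReal 1 ∂μ ≤ ENNReal.ofReal C ∧
      ∫⁻ x in {x | 1 < |u x|}ᶜ, ENNReal.ofReal (|u x| ^ (n * p x / (n - p x))) ∂μ ≤
        ENNReal.ofReal C := by
  have hR1 : 1 < R := hpinf1.trans_le hpinfR
  have hn1 : 1 < n := by linarith
  have hn0 : 0 < n := by linarith
  have hnR : 0 < n - R := by linarith
  have hn' : 0 ≤ n / (n - 1) := div_nonneg hn0.le (by linarith)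
  obtain ⟨S, hS, hsob⟩ := exists_sobolev_const μ hn hn1
  set Q : ℝ := n * pinf / (n - pinf) with hQ
  set s : ℝ := Q * (1 - 1 / n) with hs
  obtain ⟨hs1, hsQ⟩ := sobolev_conj_exponent hpinf1 (hpinfR.trans_lt hRn)
  have hs0 : 0 < s := by linarith
  have hexp : ∀ r : ℝ, 1 < r → r < n → 1 ≤ n * r / (n - r) := fun r h1 h2 => by
    rw [le_div_iff₀ (by linarith)]; nlinarith
  have hQ1 : 1 ≤ Q := hexp pinf hpinf1 (by linarith)
  set m : ℝ := n + 1 with hm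
  have hIfin := finite_integral_one_add_norm (E := E) (μ := μ) (r := m) (by rw [hn]; linarith)
  set I : ℝ := (∫⁻ x : E, ENNReal.ofReal ((1 + ‖x‖) ^ (-m)) ∂μ).toReal with hI
  have hI0 : 0 ≤ I := ENNReal.toReal_nonneg
  have hIle : ∫⁻ x : E, ENNReal.ofReal ((1 + ‖x‖) ^ (-m)) ∂μ ≤ ENNReal.ofReal I :=
    (ENNReal.ofReal_toReal hIfin.ne).ge
  have hρ : ∀ x : E, (Real.exp 1 + ‖x‖) ^ (-m) ≤ (1 + ‖x‖) ^ (-m) := fun x =>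
    Real.rpow_le_rpow_of_nonpos (by positivity)
      (by linarith [Real.one_le_exp (zero_le_one : (0 : ℝ) ≤ 1)]) (by linarith)
  obtain ⟨δ, C₁, hδ, hC₁, habs⟩ := exists_bound_of_absorb (n := n) (R := R)
    (c := S) (D := 0) (a := s * (1 + Real.exp (m * C₀) + I)) (l := 0)
    hR1 hRn hS (by positivity) le_rfl
  set C₂ : ℝ := n ^ 2 / (n - R) ^ 2 * C₀ with hC₂
  refine ⟨2 ^ Q * C₁ + (Real.exp (m * C₂) * 2 ^ Q * C₁ + I), by positivity,
    fun u hu hcu hgrad => ?_⟩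
  set G : Set E := {x | 1 < |u x|} with hG
  have hGm : MeasurableSet G := measurableSet_lt measurable_const hu.continuous.abs.measurable
  set v : E → ℝ := fun x => smoothTrunc (u x) with hv
  have hvC : ContDiff ℝ 1 v := contDiff_smoothTrunc.comp hu
  have hcv : HasCompactSupport v := hcu.comp_left (g := smoothTrunc) (by simp [smoothTrunc])
  have hvd : ∀ x, ‖fderiv ℝ v x‖ ≤ ‖fderiv ℝ u x‖ := fun x => by
    have h1 : HasFDerivAt v (deriv smoothTrunc (u x) • fderiv ℝ u x) x :=
      ((contDiff_smoothTrunc.differentiable one_ne_zero) (u x)).hasDerivAt.comp_hasFDerivAt x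
        ((hu.differentiable one_ne_zero) x).hasFDerivAt
    rw [h1.fderiv, norm_smul, Real.norm_eq_abs]
    exact mul_le_of_le_one_left (norm_nonneg _) (abs_deriv_smoothTrunc_le _)
  have hvQc : Continuous fun x => |v x| ^ Q :=
    hvC.continuous.abs.rpow_const fun x => Or.inr (by linarith)
  have hAfin : ∫⁻ x, ENNReal.ofReal (|v x| ^ Q) ∂μ ≠ ⊤ := by
    have hinteg : Integrable (fun x => |v x| ^ Q) μ := by
      refine hvQc.integrable_of_hasCompactSupport (hcv.mono fun x hx => ?_)
      contrapose! hx
      simp only [Function.mem_support, not_not] at hx ⊢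
      rw [hx, abs_zero, Real.zero_rpow (by linarith)]
    exact hinteg.lintegral_lt_top.ne
  set A : ENNReal := ∫⁻ x, ENNReal.ofReal (|v x| ^ Q) ∂μ with hA
  set g : E → ℝ := fun x => s * (|v x| ^ (s - 1) * ‖fderiv ℝ u x‖) with hg
  set J : ENNReal := ∫⁻ x, ENNReal.ofReal (g x) ∂μ with hJ
  have hJle : ∀ ε : ℝ, 0 < ε → ε ≤ 1 → J ≤ ENNReal.ofReal (s * (1 + Real.exp (m * C₀) + I) *
      (ε * A.toReal + ε ^ (1 - R))) := by
    intro ε hε hε1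
    have hεR : 1 ≤ ε ^ (1 - R) := Real.one_le_rpow_of_pos_of_le_one_of_nonpos hε hε1 (by linarith)
    have hdm : Continuous fun x => ‖fderiv ℝ u x‖ ^ p x :=
      (hu.continuous_fderiv one_ne_zero).norm.rpow hp fun x => Or.inr (by linarith [hp1 x])
    have key := lintegral_ofReal_le_of_le_combination (ν := μ) (g := g)
      (f₁ := fun x => |v x| ^ Q) (f₂ := fun x => ‖fderiv ℝ u x‖ ^ p x)
      (f₃ := fun x => (1 + ‖x‖) ^ (-m)) (c₁ := s * ε)
      (c₂ := s * (ε ^ (1 - R) * (1 + Real.exp (m * C₀)))) (c₃ := s * ε ^ (1 - R))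
      (I₁ := A.toReal) (I₂ := 1) (I₃ := I)
      (by positivity) (by positivity) (by positivity) (by positivity) zero_le_one hI0
      hvQc.measurable.aemeasurable hdm.measurable.aemeasurable
      (Eventually.of_forall fun x => ?_) (ENNReal.ofReal_toReal hAfin).ge
      (by simpa using hgrad) hIle
    · refine key.trans (ENNReal.ofReal_le_ofReal ?_)
      have h1 : 0 ≤ s * (ε * A.toReal) * (Real.exp (m * C₀) + I) := by positivity
      nlinarith
    · have hX0 : 0 ≤ |v x| ^ Q := by positivity
      have hI1 : 0 ≤ (1 + ‖x‖) ^ (-m) := by positivity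
      have hE0 := Real.exp_pos (m * C₀)
      have hd0 : 0 ≤ ‖fderiv ℝ u x‖ ^ p x := by positivity
      have y1 : |v x| ^ (s - 1) * ‖fderiv ℝ u x‖ ≤ ε * |v x| ^ Q +
          ε ^ (1 - R) * (1 + Real.exp (m * C₀)) * ‖fderiv ℝ u x‖ ^ p x +
          ε ^ (1 - R) * (1 + ‖x‖) ^ (-m) := by
        rcases le_or_gt ‖fderiv ℝ u x‖ 1 with hd | hd
        · have h1 := rpow_mul_le_add_of_pos hX0 (norm_nonneg (fderiv ℝ u x)) hpinf1 hε
          rw [← Real.rpow_mul (abs_nonneg _), ← hsQ] at h1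
          have h2 := rpow_le_const_mul_rpow_add (norm_nonneg (fderiv ℝ u x)) hd hpinf1.le
            (by linarith [norm_nonneg x] : Real.exp 1 ≤ Real.exp 1 + ‖x‖)
            (by linarith : 0 ≤ m) (by rw [abs_sub_comm]; exact hdecay x)
          have h3 : ε ^ (1 - pinf) ≤ ε ^ (1 - R) :=
            Real.rpow_le_rpow_of_exponent_ge hε hε1 (by linarith)
          have h4 := mul_le_mul h3 (h2.trans (add_le_add_right (hρ x) _)) (by positivity)
            (by positivity)
          have h5 : 0 ≤ ε ^ (1 - R) * ‖fderiv ℝ u x‖ ^ p x := by positivity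
          nlinarith
        · have h1 : |v x| ^ (s - 1) ≤ 1 :=
            Real.rpow_le_one (abs_nonneg _) (abs_smoothTrunc_le_one _) (by linarith)
          have h2 : ‖fderiv ℝ u x‖ ≤ ‖fderiv ℝ u x‖ ^ p x := by
            conv_lhs => rw [← Real.rpow_one ‖fderiv ℝ u x‖]
            exact Real.rpow_le_rpow_of_exponent_le hd.le (hp1 x).le
          have h3 : |v x| ^ (s - 1) * ‖fderiv ℝ u x‖ ≤ ‖fderiv ℝ u x‖ ^ p x :=
            (mul_le_of_le_one_left (norm_nonneg _) h1).trans h2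
          have h4 : 1 * ‖fderiv ℝ u x‖ ^ p x ≤
              ε ^ (1 - R) * (1 + Real.exp (m * C₀)) * ‖fderiv ℝ u x‖ ^ p x := by
            gcongr
            nlinarith
          have h5 : 0 ≤ ε * |v x| ^ Q := by positivity
          have h6 : 0 ≤ ε ^ (1 - R) * (1 + ‖x‖) ^ (-m) := by positivity
          linarith
      calc g x ≤ _ := mul_le_mul_of_nonneg_left y1 hs0.le
        _ = _ := by ring
  have hJtop : J ≠ ⊤ := ne_top_of_le_ne_top ENNReal.ofReal_ne_top (hJle 1 one_pos le_rfl)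
  have hAJ : A ≤ ENNReal.ofReal (S * J.toReal ^ (n / (n - 1))) := by
    have h1 := hsob (fun x => ‖v x‖ ^ s) g (hvC.norm_rpow hs1) ?_ fun x => ?_
    · rw [ENNReal.ofReal_mul hS, ← ENNReal.ofReal_rpow_of_nonneg ENNReal.toReal_nonneg hn',
        ENNReal.ofReal_toReal hJtop]
      refine le_trans (le_of_eq ?_) h1
      rw [hA]
      congr with x
      rw [abs_of_nonneg (by positivity : 0 ≤ ‖v x‖ ^ s), Real.norm_eq_abs,
        ← Real.rpow_mul (abs_nonneg _)]
      congr 2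
      have : n - 1 ≠ 0 := by linarith
      rw [hs]; field_simp
    · refine hcv.mono fun x hx => ?_
      contrapose! hx
      simp only [Function.mem_support, not_not] at hx ⊢
      rw [hx, norm_zero, Real.zero_rpow hs0.ne']
    · refine (norm_fderiv_norm_rpow_le (hvC.differentiable one_ne_zero) hs1).trans ?_
      rw [Real.norm_eq_abs, mul_assoc]
      exact mul_le_mul_of_nonneg_left (mul_le_mul_of_nonneg_left (hvd x) (by positivity)) hs0.le
  have hAC : A ≤ ENNReal.ofReal C₁ := by
    rw [ENNReal.le_ofReal_iff_toReal_le hAfin hC₁]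
    refine habs A.toReal J.toReal 0 ENNReal.toReal_nonneg ENNReal.toReal_nonneg (by positivity)
      ?_ ?_
    · have := ENNReal.toReal_le_of_le_ofReal (by positivity) hAJ
      linarith
    · intro ε η hε hε1 hη
      have := ENNReal.toReal_le_of_le_ofReal (by positivity) (hJle ε hε hε1)
      linarith
  have hrestr : ∀ H : Set E, ∫⁻ x in H, ENNReal.ofReal (|v x| ^ Q) ∂μ ≤ ENNReal.ofReal C₁ :=
    fun H => (lintegral_mono' Measure.restrict_le_self le_rfl).trans hAC
  have hrestrI : ∀ H : Set E, ∫⁻ x in H, ENNReal.ofReal ((1 + ‖x‖) ^ (-m)) ∂μ ≤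
      ENNReal.ofReal I := fun H => (lintegral_mono' Measure.restrict_le_self le_rfl).trans hIle
  constructor
  · have key := lintegral_ofReal_le_of_le_combination (ν := μ.restrict G) (g := fun _ => 1)
      (f₁ := fun x => |v x| ^ Q) (f₂ := fun _ => 0) (f₃ := fun _ => 0) (c₁ := 2 ^ Q) (c₂ := 0)
      (c₃ := 0) (I₁ := C₁) (I₂ := 0) (I₃ := 0) (by positivity) le_rfl le_rfl hC₁ le_rfl le_rfl
      hvQc.measurable.aemeasurable (by fun_prop)
      ((ae_restrict_mem hGm).mono fun x hx => ?_) (hrestr G) (by simp) (by simp)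
    · refine key.trans (ENNReal.ofReal_le_ofReal ?_)
      have : 0 ≤ Real.exp (m * C₂) * 2 ^ Q * C₁ + I := by positivity
      linarith
    · have h1 : 1 ≤ 2 * |v x| := one_le_two_mul_abs_smoothTrunc (le_of_lt hx)
      have h2 : (1 : ℝ) ≤ (2 * |v x|) ^ Q := Real.one_le_rpow h1 (by linarith)
      rw [Real.mul_rpow (by norm_num) (abs_nonneg _)] at h2
      linarith
  · have key := lintegral_ofReal_le_of_le_combination (ν := μ.restrict Gᶜ)
      (g := fun x => |u x| ^ (n * p x / (n - p x)))
      (f₁ := fun x => |v x| ^ Q) (f₂ := fun x => (1 + ‖x‖) ^ (-m)) (f₃ := fun _ => 0)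
      (c₁ := Real.exp (m * C₂) * 2 ^ Q) (c₂ := 1)
      (c₃ := 0) (I₁ := C₁) (I₂ := I) (I₃ := 0) (by positivity) zero_le_one le_rfl hC₁ hI0 le_rfl
      hvQc.measurable.aemeasurable (by fun_prop)
      ((ae_restrict_mem hGm.compl).mono fun x hx => ?_) (hrestr _) (hrestrI _) (by simp)
    · refine key.trans (ENNReal.ofReal_le_ofReal ?_)
      have : 0 ≤ 2 ^ Q * C₁ := by positivity
      linarith
    · have hux : |u x| ≤ 1 := not_lt.1 hx
      have h1 : |u x| ^ Q ≤ (2 * |v x|) ^ Q := Real.rpow_le_rpow (abs_nonneg _)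
        (abs_le_two_mul_abs_smoothTrunc hux) (by linarith)
      rw [Real.mul_rpow (by norm_num) (abs_nonneg _)] at h1
      have hlog : 0 < Real.log (Real.exp 1 + ‖x‖) := by
        apply Real.log_pos
        have := Real.add_one_lt_exp (one_ne_zero : (1 : ℝ) ≠ 0)
        linarith [norm_nonneg x]
      have h2 : |n * p x / (n - p x) - Q| ≤ C₂ / Real.log (Real.exp 1 + ‖x‖) := by
        refine (abs_sobolev_exponent_sub_le hn0 (hpR x) hpinfR hRn).trans ?_
        rw [hC₂, mul_div_assoc]
        gcongr
        exact hdecay x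
      have h3 := rpow_le_const_mul_rpow_add (abs_nonneg (u x)) hux
        (hexp (p x) (hp1 x) ((hpR x).trans_lt hRn))
        (by linarith [norm_nonneg x] : Real.exp 1 ≤ Real.exp 1 + ‖x‖)
        (by linarith : 0 ≤ m) h2
      have h4 := mul_le_mul_of_nonneg_left h1 (Real.exp_pos (m * C₂)).le
      linarith [hρ x]

/-- Higher integrability on the set where `u` is large, from a bound on its measure. -/
lemma exists_lintegral_large_rpow_le (hn : (Module.finrank ℝ E : ℝ) = n) (hn1 : 1 < n)
    {p : E → ℝ} (hp1 : ∀ x, 1 < p x) {M : ℝ} (hM : 0 ≤ M) :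
    ∃ D : ℝ, 0 ≤ D ∧ ∀ u : E → ℝ, ContDiff ℝ 1 u → HasCompactSupport u →
      ∫⁻ x, ENNReal.ofReal (‖fderiv ℝ u x‖ ^ p x) ∂μ ≤ 1 →
      ∫⁻ _ in {x | 1 < |u x|}, ENNReal.ofReal 1 ∂μ ≤ ENNReal.ofReal M →
      ∫⁻ x in {x | 1 < |u x|}, ENNReal.ofReal (|u x| ^ (n / (n - 1))) ∂μ ≤
        ENNReal.ofReal D := by
  have hn' : 0 ≤ n / (n - 1) := div_nonneg (by linarith) (by linarith)
  obtain ⟨S, hS, hsob⟩ := exists_sobolev_const μ hn hn1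
  refine ⟨2 ^ (n / (n - 1)) * 2 ^ (n / (n - 1)) * (S * (M + 1) ^ (n / (n - 1))) +
    2 ^ (n / (n - 1)) * 2 ^ (n / (n - 1)) * M + 0 * 0, by positivity,
    fun u hu hcu hgrad hmeas => ?_⟩
  set G : Set E := {x | 1 < |u x|} with hG
  have hGm : MeasurableSet G := measurableSet_lt measurable_const hu.continuous.abs.measurable
  set w : E → ℝ := fun x => smoothExcess 1 (u x) with hw
  have hwC : ContDiff ℝ 1 w := contDiff_smoothExcess.comp hu
  have hcw : HasCompactSupport w := hcu.smoothExcess_comp zero_le_one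
  have hw0 : ∀ x, 0 ≤ w x := fun x => smoothExcess_nonneg _
  have hone : ∫⁻ x, ENNReal.ofReal (G.indicator (fun _ => 1) x) ∂μ ≤ ENNReal.ofReal M := by
    refine le_trans (le_of_eq ?_) hmeas
    rw [← lintegral_indicator hGm]
    congr with x
    by_cases hx : x ∈ G <;> simp [hx]
  have hfd : ∀ x, ‖fderiv ℝ w x‖ ≤ G.indicator (fun _ => 1) x + ‖fderiv ℝ u x‖ ^ p x := fun x => by
    have hd0 : 0 ≤ ‖fderiv ℝ u x‖ ^ p x := by positivity
    by_cases hx : x ∈ G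
    · refine (norm_fderiv_smoothExcess_comp_le hu x).1.trans ?_
      rw [Set.indicator_of_mem hx]
      rcases le_or_gt ‖fderiv ℝ u x‖ 1 with h | h
      · linarith
      · have h2 : ‖fderiv ℝ u x‖ ≤ ‖fderiv ℝ u x‖ ^ p x := by
          conv_lhs => rw [← Real.rpow_one ‖fderiv ℝ u x‖]
          exact Real.rpow_le_rpow_of_exponent_le h.le (hp1 x).le
        linarith
    · have : fderiv ℝ w x = 0 := (norm_fderiv_smoothExcess_comp_le hu x).2 (not_lt.1 hx)
      rw [this, norm_zero, Set.indicator_of_notMem hx, zero_add]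
      exact hd0
  have h1 : ∫⁻ x in G, ENNReal.ofReal (|w x| ^ (n / (n - 1))) ∂μ ≤
      ENNReal.ofReal (S * (M + 1) ^ (n / (n - 1))) := by
    refine (lintegral_mono' Measure.restrict_le_self le_rfl).trans
      ((hsob w _ hwC hcw hfd).trans ?_)
    rw [ENNReal.ofReal_mul hS, ← ENNReal.ofReal_rpow_of_nonneg (by linarith) hn']
    gcongr
    have := lintegral_ofReal_le_of_le_combination (ν := μ)
      (g := fun x => G.indicator (fun _ => 1) x + ‖fderiv ℝ u x‖ ^ p x)
      (f₁ := G.indicator (fun _ => 1)) (f₂ := fun _ => 0) (f₃ := fun x => ‖fderiv ℝ u x‖ ^ p x)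
      (c₁ := 1) (c₂ := 0) (c₃ := 1) (I₁ := M) (I₂ := 0) (I₃ := 1) zero_le_one le_rfl zero_le_one
      hM le_rfl zero_le_one ((measurable_const.indicator hGm).aemeasurable) (by fun_prop)
      (Eventually.of_forall fun x => by simp) hone (by simp) (by simpa using hgrad)
    simpa using this
  refine lintegral_ofReal_le_of_le_combination (f₂ := fun _ => 1) (f₃ := fun _ => 0)
    (by positivity) (by positivity) le_rfl (by positivity) hM le_rfl
    ((hwC.continuous.abs.rpow_const fun x => Or.inr hn').measurable.aemeasurable)
    (by fun_prop) (Eventually.of_forall fun x => ?_) h1 hmeas (by simp)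
  have h2 : |u x| ≤ 2 * (1 + w x) := by
    have : |u x| ≤ w x + 1 + 1 := abs_le_smoothExcess_add _
    linarith [hw0 x]
  have h3 := rpow_le_two_rpow_mul_sub_one_rpow_add (by linarith [hw0 x] : 1 ≤ 1 + w x) hn'
  have h4 : |u x| ^ (n / (n - 1)) ≤ 2 ^ (n / (n - 1)) * (1 + w x) ^ (n / (n - 1)) := by
    rw [← Real.mul_rpow (by norm_num) (by linarith [hw0 x])]
    exact Real.rpow_le_rpow (abs_nonneg _) h2 hn'
  have h5 := mul_le_mul_of_nonneg_left h3 (by positivity : (0 : ℝ) ≤ 2 ^ (n / (n - 1)))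
  rw [add_sub_cancel_left] at h5
  rw [abs_of_nonneg (hw0 x)]
  linarith

end

section Modular

variable {E : Type*} [NormedAddCommGroup E] [InnerProductSpace ℝ E] [FiniteDimensional ℝ E]
  [MeasurableSpace E] [BorelSpace E] (μ : Measure E) [μ.IsAddHaarMeasure] {n R : ℝ}

/-- Sobolev estimate for modulars when the lower order term controls `|u| ^ p`. -/
lemma exists_lintegral_rpow_le_of_le_weight (hn : (Module.finrank ℝ E : ℝ) = n) {K : NNReal}
    {p q V : E → ℝ} {m a : ℝ} (hp : LipschitzWith K p) (hm : 1 < m) (hmp : ∀ x, m ≤ p x)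
    (hpR : ∀ x, p x ≤ R) (hRn : R < n) (ha : 0 < a) (hV : ∀ᵐ x ∂μ, a ≤ V x)
    (hpq : ∀ x, p x ≤ q x) (hq : ∀ x, q x ≤ n * p x / (n - p x)) :
    ∃ C : ℝ, 0 ≤ C ∧ ∀ u : E → ℝ, ContDiff ℝ 1 u → HasCompactSupport u →
      ∫⁻ x, ENNReal.ofReal (‖fderiv ℝ u x‖ ^ p x) ∂μ ≤ 1 →
      ∫⁻ x, ENNReal.ofReal (V x * |u x| ^ p x) ∂μ ≤ 1 →
      ∫⁻ x, ENNReal.ofReal (|u x| ^ q x) ∂μ ≤ ENNReal.ofReal C := by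
  have ha' : 0 ≤ a⁻¹ := by positivity
  obtain ⟨C, hC, hlarge⟩ := exists_lintegral_large_le μ hn hp
    (fun x => hm.trans_le (hmp x)) hpR hRn hm ha'
  refine ⟨C + a⁻¹, by positivity, fun u hu hcu hgrad hmod => ?_⟩
  set G : Set E := {x | 1 < |u x|} with hG
  have hGm : MeasurableSet G := measurableSet_lt measurable_const hu.continuous.abs.measurable
  have hup : ∫⁻ x, ENNReal.ofReal (|u x| ^ p x) ∂μ ≤ ENNReal.ofReal a⁻¹ := by
    calc ∫⁻ x, ENNReal.ofReal (|u x| ^ p x) ∂μ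
        ≤ ∫⁻ x, ENNReal.ofReal a⁻¹ * ENNReal.ofReal (V x * |u x| ^ p x) ∂μ := by
          refine lintegral_mono_ae (hV.mono fun x hx => ?_)
          rw [← ENNReal.ofReal_mul ha']
          refine ENNReal.ofReal_le_ofReal ?_
          rw [← mul_assoc]
          refine le_mul_of_one_le_left (by positivity) ?_
          rw [inv_mul_eq_div, one_le_div ha]
          exact hx
      _ = ENNReal.ofReal a⁻¹ * ∫⁻ x, ENNReal.ofReal (V x * |u x| ^ p x) ∂μ :=
          lintegral_const_mul' _ _ ENNReal.ofReal_ne_top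
      _ ≤ ENNReal.ofReal a⁻¹ := mul_le_of_le_one_right' hmod
  rw [← lintegral_add_compl _ hGm, ENNReal.ofReal_add hC ha']
  refine add_le_add ?_ ?_
  · refine le_trans (setLIntegral_mono' hGm fun x hx => ENNReal.ofReal_le_ofReal
      (Real.rpow_le_rpow_of_exponent_le (le_of_lt hx) (hq x))) (hlarge u hu hcu hgrad ?_)
    exact (setLIntegral_mono' hGm fun x hx => ENNReal.ofReal_le_ofReal
      (Real.rpow_le_rpow_of_exponent_le (le_of_lt hx) (hmp x))).trans
      ((setLIntegral_le_lintegral _ _).trans hup)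
  · refine (setLIntegral_mono' hGm.compl fun x hx => ENNReal.ofReal_le_ofReal
      (Real.rpow_le_rpow_of_exponent_ge' (abs_nonneg _) (not_lt.1 hx) ?_ (hpq x))).trans
      ((setLIntegral_le_lintegral _ _).trans hup)
    linarith [hmp x]

/-- Sobolev estimate for modulars when `q` is critical outside a set of finite measure. -/
lemma exists_lintegral_rpow_le_of_noncritical_finite (hn : (Module.finrank ℝ E : ℝ) = n)
    {K : NNReal} {p q : E → ℝ} {m pinf C₀ : ℝ} (hp : LipschitzWith K p) (hm : 1 < m)
    (hmp : ∀ x, m ≤ p x) (hpR : ∀ x, p x ≤ R) (hRn : R < n)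
    (hdecay : ∀ x, |p x - pinf| ≤ C₀ / Real.log (Real.exp 1 + ‖x‖))
    (hqc : Continuous q) (hpq : ∀ x, p x ≤ q x) (hq : ∀ x, q x ≤ n * p x / (n - p x))
    (hfin : μ {x | q x ≠ n * p x / (n - p x)} < ⊤) :
    ∃ C : ℝ, 0 ≤ C ∧ ∀ u : E → ℝ, ContDiff ℝ 1 u → HasCompactSupport u →
      ∫⁻ x, ENNReal.ofReal (‖fderiv ℝ u x‖ ^ p x) ∂μ ≤ 1 →
      ∫⁻ x, ENNReal.ofReal (|u x| ^ q x) ∂μ ≤ ENNReal.ofReal C := by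
  have hp1 : ∀ x, 1 < p x := fun x => hm.trans_le (hmp x)
  have hn1 : 1 < n := ((hp1 0).trans_le (hpR 0)).trans hRn
  have : Nontrivial E := Module.nontrivial_of_finrank_pos (R := ℝ) (by
    have : (0 : ℝ) < Module.finrank ℝ E := by rw [hn]; linarith
    exact_mod_cast this)
  have : NoncompactSpace E := NormedSpace.noncompactSpace ℝ E
  have hlim : Tendsto p (cocompact E) (𝓝 pinf) := by
    refine tendsto_iff_norm_sub_tendsto_zero.2 ?_
    refine squeeze_zero (fun x => norm_nonneg _) hdecay ?_
    exact tendsto_const_nhds.div_atTop (Real.tendsto_log_atTop.comp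
      (tendsto_atTop_add_const_left _ _ tendsto_norm_cocompact_atTop))
  have hpinf1 : 1 < pinf := hm.trans_le (ge_of_tendsto' hlim hmp)
  have hpinfR : pinf ≤ R := le_of_tendsto' hlim hpR
  obtain ⟨M, hM, hsmall⟩ := exists_lintegral_small_le μ hn hp.continuous hp1 hpR hRn hpinf1
    hpinfR hdecay
  obtain ⟨D, hD, hmid⟩ := exists_lintegral_large_rpow_le μ hn hn1 hp1 hM
  have hγ : 1 < n / (n - 1) := by rw [one_lt_div (by linarith)]; linarith
  obtain ⟨C, hC, hlarge⟩ := exists_lintegral_large_le μ hn hp hp1 hpR hRn hγ hD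
  set A : Set E := {x | q x ≠ n * p x / (n - p x)} with hA
  have hAm : MeasurableSet A := by
    have hpm := hp.continuous.measurable
    exact (measurableSet_eq_fun hqc.measurable
      ((hpm.const_mul n).div (measurable_const.sub hpm))).compl
  refine ⟨C + (M + (μ A).toReal), by positivity, fun u hu hcu hgrad => ?_⟩
  set G : Set E := {x | 1 < |u x|} with hG
  have hGm : MeasurableSet G := measurableSet_lt measurable_const hu.continuous.abs.measurable
  obtain ⟨hs₁, hs₂⟩ := hsmall u hu hcu hgrad
  rw [← lintegral_add_compl _ hGm, ENNReal.ofReal_add hC (by positivity),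
    ENNReal.ofReal_add hM ENNReal.toReal_nonneg, ENNReal.ofReal_toReal hfin.ne]
  refine add_le_add ?_ ?_
  · exact le_trans (setLIntegral_mono' hGm fun x hx => ENNReal.ofReal_le_ofReal
      (Real.rpow_le_rpow_of_exponent_le (le_of_lt hx) (hq x)))
      (hlarge u hu hcu hgrad (hmid u hu hcu hgrad hs₁))
  · calc ∫⁻ x in Gᶜ, ENNReal.ofReal (|u x| ^ q x) ∂μ
        ≤ ∫⁻ x in Gᶜ, (ENNReal.ofReal (|u x| ^ (n * p x / (n - p x))) +
            A.indicator 1 x) ∂μ := by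
          refine setLIntegral_mono' hGm.compl fun x hx => ?_
          by_cases hxA : x ∈ A
          · rw [Set.indicator_of_mem hxA, Pi.one_apply]
            refine le_add_left ?_
            rw [← ENNReal.ofReal_one]
            exact ENNReal.ofReal_le_ofReal (Real.rpow_le_one (abs_nonneg _) (not_lt.1 hx)
              (by linarith [hp1 x, hpq x]))
          · have : q x = n * p x / (n - p x) := not_not.1 hxA
            rw [this]
            exact le_self_add
      _ = ∫⁻ x in Gᶜ, ENNReal.ofReal (|u x| ^ (n * p x / (n - p x))) ∂μ +
            ∫⁻ x in Gᶜ, A.indicator 1 x ∂μ :=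
          lintegral_add_right _ (measurable_one.indicator hAm)
      _ ≤ ENNReal.ofReal M + μ A := by
          refine add_le_add hs₂ ((setLIntegral_le_lintegral _ _).trans ?_)
          rw [lintegral_indicator_one hAm]

end Modular

lemma exists_pos_le_ae_of_essInf_ne_zero {α : Type*} [MeasurableSpace α] {μ : Measure α}
    {V : α → ℝ} (hV : ∀ᵐ x ∂μ, 0 < V x) (h : essInf V μ ≠ 0) :
    ∃ a : ℝ, 0 < a ∧ ∀ᵐ x ∂μ, a ≤ V x := by
  by_contra hcon
  refine h ?_
  have hset : {a : ℝ | ∀ᵐ x ∂μ, a ≤ V x} = Set.Iic 0 := by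
    ext a
    refine ⟨fun ha => ?_, fun ha => hV.mono fun x hx => le_trans ha hx.le⟩
    by_contra hna
    exact hcon ⟨a, not_le.1 hna, ha⟩
  have : essInf V μ = sSup {a : ℝ | ∀ᵐ x ∂μ, a ≤ V x} := by
    rw [essInf, liminf_eq]
  rw [this, hset, csSup_Iic]

section Luxemburg

variable {N : ℕ} {w p f : EuclideanSpace ℝ (Fin N) → ℝ}

lemma rpow_abs_div_le {t c r : ℝ} (hc : 1 ≤ c) (hr : 1 ≤ r) : |t / c| ^ r ≤ c⁻¹ * |t| ^ r := by
  have hc0 : 0 < c := by linarith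
  rw [abs_div, abs_of_pos hc0, Real.div_rpow (abs_nonneg _) hc0.le, inv_mul_eq_div]
  gcongr
  exact Real.self_le_rpow_of_one_le hc hr

lemma integrable_mul_abs_rpow (hw : Measurable w)
    (hwb : ∀ r : ℝ, 0 < r → ∃ C : ℝ,
      ∀ᵐ x ∂(volume.restrict (Metric.ball (0 : EuclideanSpace ℝ (Fin N)) r)), ‖w x‖ ≤ C)
    (hp : Continuous p) (hp0 : ∀ x, 0 < p x) (hf : Continuous f) (hcf : HasCompactSupport f) :
    Integrable (fun x => w x * |f x| ^ p x) := by
  obtain ⟨r, hr0, hr⟩ := hcf.isCompact.isBounded.subset_ball_lt 0 0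
  obtain ⟨C, hC⟩ := hwb r hr0
  have hcont : Continuous fun x => |f x| ^ p x :=
    hf.abs.rpow hp fun x => Or.inr (hp0 x)
  have hzero : ∀ x, f x = 0 → |f x| ^ p x = 0 := fun x hx => by
    rw [hx, abs_zero, Real.zero_rpow (hp0 x).ne']
  have hcs : HasCompactSupport fun x => |f x| ^ p x :=
    hcf.mono fun x hx hfx => hx (hzero x hfx)
  have hinteg : Integrable (fun x => |f x| ^ p x) := hcont.integrable_of_hasCompactSupport hcs
  refine (integrableOn_iff_integrable_of_support_subset
    (s := Metric.ball (0 : EuclideanSpace ℝ (Fin N)) r) fun x hx => hr (subset_tsupport _ ?_)).1 ?_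
  · intro hfx
    exact hx (by simp only [hzero x hfx, mul_zero])
  · exact hinteg.integrableOn.bdd_mul hw.aestronglyMeasurable hC

lemma luxNormW_lt_exists (hw0 : ∀ᵐ x, 0 ≤ w x) (hp1 : ∀ x, 1 ≤ p x)
    (hinteg : Integrable (fun x => w x * |f x| ^ p x)) {δ : ℝ} (hδ : 0 < δ) :
    ∃ c : ℝ, 0 < c ∧ c < luxNormW w p f + δ ∧ ∫ x, w x * |f x / c| ^ p x ≤ 1 := by
  have hne : {c : ℝ | 0 < c ∧ ∫ x, w x * |f x / c| ^ p x ≤ 1}.Nonempty := by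
    set I := ∫ x, w x * |f x| ^ p x with hI
    have hc : 1 ≤ max 1 I := le_max_left _ _
    have hc0 : 0 < max 1 I := by positivity
    refine ⟨max 1 I, hc0, ?_⟩
    calc ∫ x, w x * |f x / max 1 I| ^ p x ≤ ∫ x, (max 1 I)⁻¹ * (w x * |f x| ^ p x) := by
          refine integral_mono_of_nonneg (hw0.mono fun x hx => ?_) (hinteg.const_mul _)
            (hw0.mono fun x hx => ?_)
          · exact mul_nonneg hx (by positivity)
          · have := mul_le_mul_of_nonneg_left (rpow_abs_div_le (t := f x) hc (hp1 x)) hx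
            dsimp only
            linarith
      _ = (max 1 I)⁻¹ * I := integral_const_mul _ _
      _ ≤ 1 := by
          rw [inv_mul_eq_div, div_le_one hc0]
          exact le_max_right _ _
  obtain ⟨c, ⟨hc0, hc⟩, hlt⟩ := exists_lt_of_csInf_lt hne
    (show sInf {c : ℝ | 0 < c ∧ ∫ x, w x * |f x / c| ^ p x ≤ 1} < luxNormW w p f + δ from
      lt_add_of_pos_right _ hδ)
  exact ⟨c, hc0, hlt, hc⟩

/-- Enlarging the divisor keeps the modular at most one. -/
lemma lintegral_modular_div_le_one (hw0 : ∀ᵐ x, 0 ≤ w x) (hp0 : ∀ x, 0 ≤ p x) {c d : ℝ}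
    (hc : 0 < c) (hcd : c ≤ d) (hinteg : Integrable (fun x => w x * |f x / c| ^ p x))
    (h : ∫ x, w x * |f x / c| ^ p x ≤ 1) :
    ∫⁻ x, ENNReal.ofReal (w x * |f x / d| ^ p x) ≤ 1 := by
  calc ∫⁻ x, ENNReal.ofReal (w x * |f x / d| ^ p x)
      ≤ ∫⁻ x, ENNReal.ofReal (w x * |f x / c| ^ p x) := by
        refine lintegral_mono_ae (hw0.mono fun x hx => ENNReal.ofReal_le_ofReal ?_)
        refine mul_le_mul_of_nonneg_left (Real.rpow_le_rpow (abs_nonneg _) ?_ (hp0 x)) hx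
        rw [abs_div, abs_div, abs_of_pos hc, abs_of_pos (hc.trans_le hcd)]
        gcongr
    _ = ENNReal.ofReal (∫ x, w x * |f x / c| ^ p x) :=
        (ofReal_integral_eq_lintegral_ofReal hinteg
          (hw0.mono fun x hx => mul_nonneg hx (by positivity))).symm
    _ ≤ 1 := by rw [← ENNReal.ofReal_one]; exact ENNReal.ofReal_le_ofReal h

lemma luxNormW_le_of_lintegral_le (hw0 : ∀ᵐ x, 0 ≤ w x) (hp1 : ∀ x, 1 ≤ p x) {c C : ℝ}
    (hc : 0 < c) (hC : 1 ≤ C)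
    (h : ∫⁻ x, ENNReal.ofReal (w x * |f x / c| ^ p x) ≤ ENNReal.ofReal C)
    (hinteg : Integrable (fun x => w x * |f x / c| ^ p x)) :
    luxNormW w p f ≤ C * c := by
  have hC0 : 0 < C := by linarith
  refine csInf_le ⟨0, fun _ hx => hx.1.le⟩ ⟨by positivity, ?_⟩
  have hle : ∫ x, w x * |f x / c| ^ p x ≤ C := by
    rw [← ofReal_integral_eq_lintegral_ofReal hinteg
      (hw0.mono fun x hx => mul_nonneg hx (by positivity))] at h
    exact (ENNReal.ofReal_le_ofReal_iff hC0.le).1 h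
  calc ∫ x, w x * |f x / (C * c)| ^ p x ≤ ∫ x, C⁻¹ * (w x * |f x / c| ^ p x) := by
        refine integral_mono_of_nonneg (hw0.mono fun x hx => ?_) (hinteg.const_mul _)
          (hw0.mono fun x hx => ?_)
        · exact mul_nonneg hx (by positivity)
        · have := mul_le_mul_of_nonneg_left (rpow_abs_div_le (t := f x / c) hC (hp1 x)) hx
          dsimp only
          rw [mul_comm C c, ← div_div]
          linarith
    _ = C⁻¹ * ∫ x, w x * |f x / c| ^ p x := integral_const_mul _ _
    _ ≤ 1 := by
        rw [inv_mul_eq_div, div_le_one hC0]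
        exact hle

end Luxemburg

lemma CondC.le_exponent {N : ℕ} {p V q b : EuclideanSpace ℝ (Fin N) → ℝ}
    (hC : CondC N p V q b) (x : EuclideanSpace ℝ (Fin N)) : p x ≤ q x := by
  have hgap := hC.gap
  have hbdd : BddBelow (Set.range fun x => q x - p x) := by
    by_contra h
    rw [Real.sInf_of_not_bddBelow h] at hgap
    exact lt_irrefl _ hgap
  have := csInf_le hbdd ⟨x, rfl⟩
  dsimp only at this
  linarith

/-- Modulars of functions in the unit ball of the Sobolev norm are uniformly bounded. -/
lemma exists_modular_bound {N : ℕ} {p V q b : EuclideanSpace ℝ (Fin N) → ℝ}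
    (hP : CondP N p V) (hC : CondC N p V q b) :
    ∃ C : ℝ, 1 ≤ C ∧ ∀ v : EuclideanSpace ℝ (Fin N) → ℝ, ContDiff ℝ 1 v → HasCompactSupport v →
      ∫⁻ x, ENNReal.ofReal (‖fderiv ℝ v x‖ ^ p x) ≤ 1 →
      ∫⁻ x, ENNReal.ofReal (V x * |v x| ^ p x) ≤ 1 →
      ∫⁻ x, ENNReal.ofReal (b x * |v x| ^ q x) ≤ ENNReal.ofReal C := by
  obtain ⟨K, hK⟩ := hP.lip
  obtain ⟨b₀, hb₀, hb⟩ := hC.bbound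
  have hmp : ∀ x, sInf (Set.range p) ≤ p x := fun x => csInf_le hP.pbddBelow ⟨x, rfl⟩
  have hpR : ∀ x, p x ≤ sSup (Set.range p) := fun x => le_csSup hP.pbddAbove ⟨x, rfl⟩
  have hpq := hC.le_exponent
  have hn : (Module.finrank ℝ (EuclideanSpace ℝ (Fin N)) : ℝ) = N := by
    rw [finrank_euclideanSpace_fin]
  obtain ⟨C, hC0, hbound⟩ : ∃ C : ℝ, 0 ≤ C ∧ ∀ v : EuclideanSpace ℝ (Fin N) → ℝ,
      ContDiff ℝ 1 v → HasCompactSupport v →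
      ∫⁻ x, ENNReal.ofReal (‖fderiv ℝ v x‖ ^ p x) ≤ 1 →
      ∫⁻ x, ENNReal.ofReal (V x * |v x| ^ p x) ≤ 1 →
      ∫⁻ x, ENNReal.ofReal (|v x| ^ q x) ≤ ENNReal.ofReal C := by
    by_cases hV : essInf V (volume : Measure (EuclideanSpace ℝ (Fin N))) = 0
    · obtain ⟨pinf, C₀, hdecay⟩ := hP.logHolderDecay hV
      obtain ⟨C, hC0, h⟩ := exists_lintegral_rpow_le_of_noncritical_finite volume hn hK
        hP.inf_gt_one hmp hpR hP.sup_lt_N hdecay hC.qcont hpq hC.q_le_pstar (hC.noncrit_finite hV)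
      exact ⟨C, hC0, fun v hv hcv hgrad _ => h v hv hcv hgrad⟩
    · obtain ⟨a, ha, haV⟩ := exists_pos_le_ae_of_essInf_ne_zero hP.Vpos hV
      exact exists_lintegral_rpow_le_of_le_weight volume hn hK hP.inf_gt_one hmp hpR hP.sup_lt_N
        ha haV hpq hC.q_le_pstar
  refine ⟨max 1 (b₀ * C), le_max_left _ _, fun v hv hcv hgrad hmod => ?_⟩
  calc ∫⁻ x, ENNReal.ofReal (b x * |v x| ^ q x)
      ≤ ∫⁻ x, ENNReal.ofReal b₀ * ENNReal.ofReal (|v x| ^ q x) := by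
        refine lintegral_mono_ae (hb.mono fun x hx => ?_)
        rw [← ENNReal.ofReal_mul hb₀.le]
        exact ENNReal.ofReal_le_ofReal (mul_le_mul_of_nonneg_right hx.2 (by positivity))
    _ = ENNReal.ofReal b₀ * ∫⁻ x, ENNReal.ofReal (|v x| ^ q x) :=
        lintegral_const_mul' _ _ ENNReal.ofReal_ne_top
    _ ≤ ENNReal.ofReal b₀ * ENNReal.ofReal C := by gcongr; exact hbound v hv hcv hgrad hmod
    _ = ENNReal.ofReal (b₀ * C) := (ENNReal.ofReal_mul hb₀.le).symm
    _ ≤ _ := ENNReal.ofReal_le_ofReal (le_max_right _ _)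

/-- Continuous imbedding `X ↪ L^{q(x)}(b,ℝ^N)` under conditions (𝒫) and (𝒞) (with `Ω = ∅`):
`|u|_{L^{q(x)}(b,ℝ^N)} ≤ C ‖u‖` for all `u ∈ C_c^∞(ℝ^N)`. -/
theorem imbedding_X_into_Lq_b
    (N : ℕ) (p V q b : EuclideanSpace ℝ (Fin N) → ℝ)
    (hP : CondP N p V) (hC : CondC N p V q b) :
    ∃ C : ℝ, 0 < C ∧
      ∀ u : EuclideanSpace ℝ (Fin N) → ℝ, ContDiff ℝ (⊤ : ℕ∞) u → HasCompactSupport u →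
        luxNormW b q u ≤ C * sobNorm p V u := by
  obtain ⟨C, hC1, hbound⟩ := exists_modular_bound hP hC
  have hC0 : 0 < C := by linarith
  refine ⟨C, hC0, fun u hu hcu => ?_⟩
  obtain ⟨K, hK⟩ := hP.lip
  obtain ⟨b₀, hb₀, hb⟩ := hC.bbound
  have hp1 : ∀ x, 1 < p x := fun x =>
    hP.inf_gt_one.trans_le (csInf_le hP.pbddBelow ⟨x, rfl⟩)
  have hp0 : ∀ x, 0 < p x := fun x => one_pos.trans (hp1 x)
  have hq1 : ∀ x, 1 < q x := fun x => (hp1 x).trans_le (hC.le_exponent x)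
  have hu1 : ContDiff ℝ 1 u := hu.of_le (by exact_mod_cast le_top)
  have hduc : Continuous fun x => ‖fderiv ℝ u x‖ := (hu1.continuous_fderiv one_ne_zero).norm
  have hcdu : HasCompactSupport fun x => ‖fderiv ℝ u x‖ := (hcu.fderiv (𝕜 := ℝ)).norm
  have hdiv : ∀ (f : EuclideanSpace ℝ (Fin N) → ℝ) (c : ℝ), HasCompactSupport f →
      HasCompactSupport fun x => f x / c := fun f c hf =>
    hf.mono fun x hx hfx => hx (by simp only [hfx, zero_div])
  have hone : ∀ r : ℝ, 0 < r → ∃ C : ℝ,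
      ∀ᵐ _ ∂(volume.restrict (Metric.ball (0 : EuclideanSpace ℝ (Fin N)) r)),
        ‖(1 : ℝ)‖ ≤ C := fun r _ => ⟨1, Eventually.of_forall fun _ => by norm_num⟩
  have hVb : ∀ r : ℝ, 0 < r → ∃ C : ℝ,
      ∀ᵐ x ∂(volume.restrict (Metric.ball (0 : EuclideanSpace ℝ (Fin N)) r)),
        ‖V x‖ ≤ C := fun r hr => by
    obtain ⟨c, C, hc, h⟩ := hP.Vloc r hr
    exact ⟨C, h.mono fun x hx => by
      rw [Real.norm_of_nonneg (hc.le.trans hx.1)]; exact hx.2⟩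
  have hbb : ∀ r : ℝ, 0 < r → ∃ C : ℝ,
      ∀ᵐ x ∂(volume.restrict (Metric.ball (0 : EuclideanSpace ℝ (Fin N)) r)),
        ‖b x‖ ≤ C := fun r _ => ⟨b₀, ae_restrict_of_ae (hb.mono fun x hx => by
      rw [Real.norm_of_nonneg hx.1.le]; exact hx.2)⟩
  have hV0 : ∀ᵐ x, 0 ≤ V x := hP.Vpos.mono fun x hx => hx.le
  have hb0 : ∀ᵐ x, 0 ≤ b x := hb.mono fun x hx => hx.1.le
  have hone0 : ∀ᵐ _ : EuclideanSpace ℝ (Fin N), (0 : ℝ) ≤ 1 :=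
    Eventually.of_forall fun _ => zero_le_one
  have hpc := hK.continuous
  refine le_of_forall_pos_le_add fun ε hε => ?_
  have hδ : 0 < ε / (2 * C) := by positivity
  obtain ⟨c₁, hc₁, hlt₁, hle₁⟩ := luxNormW_lt_exists (w := fun _ => 1) hone0
    (fun x => (hp1 x).le) (integrable_mul_abs_rpow measurable_const hone hpc hp0 hduc hcdu) hδ
  obtain ⟨c₂, hc₂, hlt₂, hle₂⟩ := luxNormW_lt_exists hV0
    (fun x => (hp1 x).le) (integrable_mul_abs_rpow hP.Vmeas hVb hpc hp0 hu.continuous hcu) hδ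
  have hc : 0 < c₁ + c₂ := by positivity
  have hmod₁ := lintegral_modular_div_le_one (w := fun _ => 1) hone0 (fun x => (hp0 x).le) hc₁
    (le_add_of_nonneg_right hc₂.le) (integrable_mul_abs_rpow measurable_const hone hpc hp0
      (hduc.div_const _) (hdiv _ _ hcdu)) hle₁
  have hmod₂ := lintegral_modular_div_le_one hV0 (fun x => (hp0 x).le) hc₂
    (le_add_of_nonneg_left hc₁.le) (integrable_mul_abs_rpow hP.Vmeas hVb hpc hp0
      (hu.continuous.div_const _) (hdiv _ _ hcu)) hle₂
  have hfd : ∀ x, ‖fderiv ℝ (fun y => u y / (c₁ + c₂)) x‖ = |‖fderiv ℝ u x‖ / (c₁ + c₂)| :=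
    fun x => by
      simp only [div_eq_inv_mul]
      rw [fderiv_const_mul (hu1.differentiable one_ne_zero x), norm_smul, abs_mul, abs_norm,
        Real.norm_eq_abs]
  have hmod := hbound (fun x => u x / (c₁ + c₂)) (hu1.div_const _) (hdiv _ _ hcu)
    (by simpa only [hfd, one_mul] using hmod₁) hmod₂
  have hfinal := luxNormW_le_of_lintegral_le hb0 (fun x => (hq1 x).le) hc hC1 hmod
    (integrable_mul_abs_rpow hC.bmeas hbb hC.qcont (fun x => one_pos.trans (hq1 x))
      (hu.continuous.div_const _) (hdiv _ _ hcu))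
  refine hfinal.trans ?_
  have hεC : C * (ε / (2 * C)) = ε / 2 := by field_simp
  have hsum : c₁ + c₂ ≤ sobNorm p V u + 2 * (ε / (2 * C)) := by
    rw [sobNorm]
    linarith
  calc C * (c₁ + c₂) ≤ C * (sobNorm p V u + 2 * (ε / (2 * C))) :=
        mul_le_mul_of_nonneg_left hsum hC0.le
    _ = C * sobNorm p V u + ε := by rw [mul_add]; linarith
end
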